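/- arXiv:1811.11585 — 10 statements merged into one kernel-verified Lean document; each statement's English description precedes it below -/
import Mathlib

section
/- Suppose there exists a point x⁰ ∈ C such that x⁰ ⪯ T_t x⁰ for all t ∈ J. Then there exists a common fixed point w ∈ Fix(Γ) such that x⁰ ⪯ w. -/
open Filter Topology RealInnerProductSpace

/-- A directed family of nonempty bounded closed convex sets in a Hilbert space has a common
point. -/
theorem exists_mem_of_directed_convex {H : Type*} [NormedAddCommGroup H] [InnerProductSpace ℝ H]
    [CompleteSpace H] {ι : Type*} [Nonempty ι] (F : ι → Set H) (R : ℝ)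
    (hdir : Directed (· ⊇ ·) F) (hne : ∀ i, (F i).Nonempty) (hcl : ∀ i, IsClosed (F i))
    (hconv : ∀ i, Convex ℝ (F i)) (hR : ∀ i, ∀ x ∈ F i, ‖x‖ ≤ R) :
    ∃ x, ∀ i, x ∈ F i := by
  have hproj : ∀ i, ∃ z ∈ F i, ∀ w ∈ F i, ‖w - z‖ ^ 2 ≤ ‖w‖ ^ 2 - ‖z‖ ^ 2 := by
    intro i
    obtain ⟨z, hz, hmin⟩ :=
      exists_norm_eq_iInf_of_complete_convex (hne i) (hcl i).isComplete (hconv i) 0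
    refine ⟨z, hz, fun w hw => ?_⟩
    have h := (norm_eq_iInf_iff_real_inner_le_zero (hconv i) hz).1 hmin w hw
    have h2 := norm_add_sq_real (w - z) z
    rw [sub_add_cancel, real_inner_comm] at h2
    rw [zero_sub, inner_neg_left] at h
    linarith
  choose z hz hzmin using hproj
  have hbdd : BddAbove (Set.range fun i => ‖z i‖ ^ 2) := by
    refine ⟨R ^ 2, ?_⟩
    rintro _ ⟨i, rfl⟩
    exact pow_le_pow_left₀ (norm_nonneg _) (hR i _ (hz i)) 2
  set L := ⨆ i, ‖z i‖ ^ 2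
  have hL : ∀ i, ‖z i‖ ^ 2 ≤ L := le_ciSup hbdd
  have hseq : ∀ n : ℕ, ∃ i, L - 1 / ((n : ℝ) + 1) < ‖z i‖ ^ 2 := fun n =>
    exists_lt_of_lt_ciSup (sub_lt_self _ Nat.one_div_pos_of_nat)
  choose k hk using hseq
  have hnear : ∀ n i, F i ⊆ F (k n) → ‖z i - z (k n)‖ ≤ √(1 / ((n : ℝ) + 1)) := by
    intro n i hi
    refine Real.le_sqrt_of_sq_le ?_
    have h1 := hzmin (k n) (z i) (hi (hz i))
    linarith [hL i, hk n]
  have hb : Tendsto (fun n : ℕ => √(1 / ((n : ℝ) + 1))) atTop (𝓝 0) := by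
    simpa using (tendsto_one_div_add_atTop_nhds_zero_nat (𝕜 := ℝ)).sqrt
  have hcauchy : CauchySeq fun n => z (k n) := by
    refine cauchySeq_of_le_tendsto_0 (fun n : ℕ => 2 * √(1 / ((n : ℝ) + 1))) ?_
      (by simpa using hb.const_mul 2)
    intro n m N hn hm
    obtain ⟨i, hin, him⟩ := hdir (k n) (k m)
    have hmono : ∀ n : ℕ, N ≤ n → √(1 / ((n : ℝ) + 1)) ≤ √(1 / ((N : ℝ) + 1)) :=
      fun n hn => Real.sqrt_le_sqrt (Nat.one_div_le_one_div hn)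
    have h1 := (hnear n i hin).trans (hmono n hn)
    have h2 := (hnear m i him).trans (hmono m hm)
    rw [← dist_eq_norm] at h1 h2
    linarith [dist_triangle_left (z (k n)) (z (k m)) (z i)]
  obtain ⟨x, hx⟩ := cauchySeq_tendsto_of_complete hcauchy
  refine ⟨x, fun i => ?_⟩
  choose j hj using fun n => hdir i (k n)
  have hlim : Tendsto (fun n => z (j n)) atTop (𝓝 x) := by
    have h0 : Tendsto (fun n => z (j n) - z (k n)) atTop (𝓝 0) :=
      squeeze_zero_norm (fun n => hnear n (j n) (hj n).2) hb
    simpa using h0.add hx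
  exact (hcl i).mem_of_tendsto hlim (Eventually.of_forall fun n => (hj n).1 (hz (j n)))

/-- Existence and uniqueness of the asymptotic center of a bounded net relative to a bounded closed
convex set in a Hilbert space. -/
theorem exists_asymptotic_center {H : Type*} [NormedAddCommGroup H] [InnerProductSpace ℝ H]
    [CompleteSpace H] {ι : Type*} (l : Filter ι) [l.NeBot] (y : ι → H) (A : Set H) (R : ℝ)
    (hAne : A.Nonempty) (hAcl : IsClosed A) (hAconv : Convex ℝ A) (hAR : ∀ x ∈ A, ‖x‖ ≤ R)
    (hy : ∀ᶠ i in l, ‖y i‖ ≤ R) :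
    ∃ w ∈ A, ∀ q ∈ A,
      (∀ r, (∀ᶠ i in l, ‖y i - w‖ ≤ r) → ∀ᶠ i in l, ‖y i - q‖ ≤ r) → q = w := by
  let S : ℝ → Set H := fun r => {z ∈ A | ∀ᶠ i in l, ‖y i - z‖ ≤ r}
  have hSmono : ∀ r r', r ≤ r' → S r ⊆ S r' := fun r r' h z hz =>
    ⟨hz.1, hz.2.mono fun i hi => hi.trans h⟩
  have hSconv : ∀ r, Convex ℝ (S r) := by
    intro r p hp q hq a b ha hb hab
    refine ⟨hAconv hp.1 hq.1 ha hb hab, ?_⟩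
    filter_upwards [hp.2, hq.2] with i hi hi'
    rw [← dist_eq_norm, dist_comm] at hi hi' ⊢
    exact convex_closedBall (y i) r hi hi' ha hb hab
  have hScl : ∀ r r', r < r' → closure (S r) ⊆ S r' := by
    intro r r' h w hw
    refine ⟨closure_minimal (fun z hz => hz.1) hAcl hw, ?_⟩
    obtain ⟨z, hz, hd⟩ := Metric.mem_closure_iff.1 hw (r' - r) (sub_pos.2 h)
    filter_upwards [hz.2] with i hi
    rw [← dist_eq_norm] at hi ⊢
    linarith [dist_triangle_right (y i) w z]
  have hSnonneg : ∀ r, (S r).Nonempty → 0 ≤ r := by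
    rintro r ⟨z, hz⟩
    obtain ⟨i, hi⟩ := hz.2.exists
    exact (norm_nonneg _).trans hi
  have hEne : {r | (S r).Nonempty}.Nonempty := by
    obtain ⟨a, ha⟩ := hAne
    refine ⟨R + R, a, ha, ?_⟩
    filter_upwards [hy] with i hi
    exact (norm_sub_le _ _).trans (add_le_add hi (hAR a ha))
  have hEbdd : BddBelow {r | (S r).Nonempty} := ⟨0, fun r hr => hSnonneg r hr⟩
  set ρ := sInf {r | (S r).Nonempty}
  have hρ : 0 ≤ ρ := le_csInf hEne fun r hr => hSnonneg r hr
  have hSne : ∀ r, ρ < r → (S r).Nonempty := by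
    intro r hr
    obtain ⟨r', hr', hlt⟩ := exists_lt_of_csInf_lt hEne hr
    exact Set.Nonempty.mono (hSmono r' r hlt.le) hr'
  obtain ⟨w, hw⟩ : ∃ w, ∀ r : Set.Ioi ρ, w ∈ closure (S r) := by
    refine exists_mem_of_directed_convex _ R ?_ (fun r => (hSne r r.2).closure)
      (fun _ => isClosed_closure) (fun r => (hSconv r).closure)
      (fun r x hx => hAR x (closure_minimal (fun z hz => hz.1) hAcl hx))
    intro r r'
    exact ⟨min r r', closure_mono (hSmono _ _ (min_le_left (r : ℝ) r')),
      closure_mono (hSmono _ _ (min_le_right (r : ℝ) r'))⟩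
  have hwS : ∀ r, ρ < r → w ∈ S r := by
    intro r hr
    obtain ⟨r', h1, h2⟩ := exists_between hr
    exact hScl r' r h2 (hw ⟨r', h1⟩)
  refine ⟨w, (hwS (ρ + 1) (lt_add_one ρ)).1, fun q hq hqr => ?_⟩
  by_contra hne
  have hd : 0 < ‖w - q‖ ^ 2 := by
    have := norm_pos_iff.2 (sub_ne_zero.2 (Ne.symm hne))
    positivity
  let r := √(ρ ^ 2 + ‖w - q‖ ^ 2 / 8)
  have hr2 : r ^ 2 = ρ ^ 2 + ‖w - q‖ ^ 2 / 8 := Real.sq_sqrt (by positivity)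
  have hr : ρ < r := Real.lt_sqrt_of_sq_lt (by linarith)
  have hwr := (hwS r hr).2
  have hmid : ∀ᶠ i in l, ‖y i - ((1 / 2 : ℝ) • w + (1 / 2 : ℝ) • q)‖ ^ 2 ≤
      r ^ 2 - ‖w - q‖ ^ 2 / 4 := by
    filter_upwards [hwr, hqr r hwr] with i h1 h2
    have hp := parallelogram_law_with_norm ℝ (y i - w) (y i - q)
    have e1 : y i - w + (y i - q) =
        (2 : ℝ) • (y i - ((1 / 2 : ℝ) • w + (1 / 2 : ℝ) • q)) := by module
    have e2 : y i - w - (y i - q) = -(w - q) := by abel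
    rw [e1, e2, norm_smul, norm_neg, Real.norm_ofNat] at hp
    have h1' := pow_le_pow_left₀ (norm_nonneg _) h1 2
    have h2' := pow_le_pow_left₀ (norm_nonneg _) h2 2
    linarith
  have hle : ρ ≤ √(r ^ 2 - ‖w - q‖ ^ 2 / 4) := by
    refine csInf_le hEbdd ⟨(1 / 2 : ℝ) • w + (1 / 2 : ℝ) • q, ?_, ?_⟩
    · exact hAconv (hwS r hr).1 hq (by norm_num) (by norm_num) (by norm_num)
    · exact hmid.mono fun i hi => Real.le_sqrt_of_sq_le hi
  obtain ⟨i, hi⟩ := hmid.exists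
  have := (Real.le_sqrt hρ ((sq_nonneg _).trans hi)).1 hle
  linarith

theorem stmt0
    {H : Type*} [NormedAddCommGroup H] [InnerProductSpace ℝ H] [CompleteSpace H]
    (K : Set H) (hKclosed : IsClosed K) (hKconvex : Convex ℝ K)
    (hKcone : ∀ (α : ℝ), 0 ≤ α → ∀ x ∈ K, α • x ∈ K)
    (hKpointed : K ∩ (-K) = {0})
    (J : Set ℝ) (hJpos : ∀ u ∈ J, (0:ℝ) ≤ u) (hJ0 : (0:ℝ) ∈ J)
    (hJadd : ∀ u ∈ J, ∀ v ∈ J, u + v ∈ J)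
    (hJunbdd : ∀ M : ℝ, ∃ u ∈ J, M < u)
    (C : Set H) (hCne : C.Nonempty) (hCbdd : Bornology.IsBounded C)
    (hCclosed : IsClosed C) (hCconvex : Convex ℝ C)
    (T : ℝ → H → H)
    (hTself : ∀ u ∈ J, ∀ x ∈ C, T u x ∈ C)
    (hT0 : ∀ x ∈ C, T 0 x = x)
    (hTsemi : ∀ u ∈ J, ∀ v ∈ J, ∀ x ∈ C, T (u + v) x = T u (T v x))
    (hTcont : ∀ x ∈ C, ContinuousOn (fun u => T u x) J)
    (hTmono : ∀ u ∈ J, ∀ x ∈ C, ∀ y ∈ C, y - x ∈ K → T u y - T u x ∈ K)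
    (hTnonexp : ∀ u ∈ J, ∀ x ∈ C, ∀ y ∈ C, (y - x ∈ K ∨ x - y ∈ K) →
      ‖T u x - T u y‖ ≤ ‖x - y‖)
    (x0 : H) (hx0 : x0 ∈ C) (hx0le : ∀ u ∈ J, T u x0 - x0 ∈ K) :
    ∃ w ∈ C, (∀ u ∈ J, T u w = w) ∧ w - x0 ∈ K := by
  have hKadd : ∀ a ∈ K, ∀ b ∈ K, a + b ∈ K := by
    intro a ha b hb
    have h := hKcone 2 zero_le_two _
      (hKconvex ha hb (by norm_num : (0 : ℝ) ≤ 1 / 2) (by norm_num : (0 : ℝ) ≤ 1 / 2)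
        (by norm_num))
    convert h using 1
    module
  have hK0 : (0 : H) ∈ K := (hKpointed.ge (Set.mem_singleton 0)).1
  obtain ⟨R, hR⟩ := hCbdd.exists_norm_le
  have hyC : ∀ t ∈ J, T t x0 ∈ C := fun t ht => hTself t ht x0 hx0
  have hyle : ∀ t ∈ J, ∀ s ∈ J, T (t + s) x0 - T t x0 ∈ K := by
    intro t ht s hs
    rw [hTsemi t ht s hs x0 hx0]
    exact hTmono t ht x0 hx0 _ (hyC s hs) (hx0le s hs)
  let F : J → Set H := fun t => {z ∈ C | z - T t x0 ∈ K}
  have hFle : ∀ t s : J, F ⟨t + s, hJadd t t.2 s s.2⟩ ⊆ F t := by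
    intro t s z hz
    refine ⟨hz.1, ?_⟩
    have := hKadd _ hz.2 _ (hyle t t.2 s s.2)
    rwa [sub_add_sub_cancel] at this
  have hFcl : ∀ t, IsClosed (F t) := fun t =>
    hCclosed.inter (hKclosed.preimage (continuous_id.sub continuous_const))
  have hFconv : ∀ t, Convex ℝ (F t) := by
    intro t p hp q hq a b ha hb hab
    refine ⟨hCconvex hp.1 hq.1 ha hb hab, ?_⟩
    have h := hKconvex hp.2 hq.2 ha hb hab
    convert h using 1
    calc a • p + b • q - T t x0 = a • p + b • q - (a + b) • T t x0 := by rw [hab, one_smul]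
      _ = _ := by module
  have : Nonempty J := ⟨⟨0, hJ0⟩⟩
  have hFdir : Directed (· ⊇ ·) F := by
    intro t s
    refine ⟨⟨t + s, hJadd t t.2 s s.2⟩, hFle t s, ?_⟩
    have h := hFle s t
    simp only [add_comm (s : ℝ)] at h
    exact h
  have hAne : (⋂ t, F t).Nonempty := by
    obtain ⟨x, hx⟩ := exists_mem_of_directed_convex F R hFdir
      (fun t => ⟨T t x0, hyC t t.2, by rwa [sub_self]⟩) hFcl hFconv
      (fun t x hx => hR x hx.1)
    exact ⟨x, Set.mem_iInter.2 hx⟩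
  have hAC : ∀ x ∈ ⋂ t, F t, x ∈ C := fun x hx => (Set.mem_iInter.1 hx ⟨0, hJ0⟩).1
  let l : Filter ℝ := ⨅ t : J, 𝓟 ((fun s => (t : ℝ) + s) '' J)
  have hdirl : Directed (· ≥ ·) fun t : J => 𝓟 ((fun s => (t : ℝ) + s) '' J) := by
    intro t s
    refine ⟨⟨t + s, hJadd t t.2 s s.2⟩, ?_, ?_⟩ <;> refine principal_mono.2 ?_ <;>
      rintro _ ⟨u, hu, rfl⟩
    · exact ⟨s + u, hJadd s s.2 u hu, by ring⟩
    · exact ⟨t + u, hJadd t t.2 u hu, by ring⟩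
  have hl : ∀ p : ℝ → Prop, (∀ᶠ i in l, p i) ↔ ∃ t ∈ J, ∀ u ∈ J, p (t + u) := by
    intro p
    rw [Filter.Eventually, mem_iInf_of_directed hdirl]
    simp only [mem_principal, Set.image_subset_iff, Subtype.exists, exists_prop]
    rfl
  have : l.NeBot := by
    refine iInf_neBot_of_directed hdirl fun t => ?_
    exact principal_neBot_iff.2 ⟨_, 0, hJ0, rfl⟩
  obtain ⟨w, hwA, huniq⟩ := exists_asymptotic_center l (fun t => T t x0) (⋂ t, F t) R hAne
    (isClosed_iInter hFcl) (convex_iInter hFconv) (fun x hx => hR x (hAC x hx))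
    ((hl _).2 ⟨0, hJ0, fun u hu => hR _ (hyC _ (hJadd 0 hJ0 u hu))⟩)
  have hwle : ∀ t ∈ J, w - T t x0 ∈ K := fun t ht => (Set.mem_iInter.1 hwA ⟨t, ht⟩).2
  have hwC := hAC w hwA
  refine ⟨w, hwC, fun s hs => huniq _ ?_ ?_, ?_⟩
  · refine Set.mem_iInter.2 fun t => ⟨hTself s hs w hwC, ?_⟩
    have h1 := hTmono s hs _ (hyC t t.2) w hwC (hwle t t.2)
    rw [← hTsemi s hs t t.2 x0 hx0, add_comm] at h1
    have := hKadd _ h1 _ (hyle t t.2 s hs)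
    rwa [sub_add_sub_cancel] at this
  · intro r hr
    obtain ⟨t, ht, h⟩ := (hl _).1 hr
    refine (hl _).2 ⟨s + t, hJadd s hs t ht, fun u hu => ?_⟩
    have htu := hJadd t ht u hu
    rw [add_assoc, hTsemi s hs _ htu x0 hx0]
    exact (hTnonexp s hs _ (hyC _ htu) w hwC (Or.inl (hwle _ htu))).trans (h u hu)
  · simpa [hT0 x0 hx0] using hwle 0 hJ0
end

section
/- If z₁, z₂ ∈ Fix(Γ) satisfy z₁ ⪯ z₂, then the whole segment between them consists of common fixed points: for every c ∈ [0,1], the point (1 − c) • z₁ + c • z₂ belongs to Fix(Γ). -/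
open Filter Topology RealInnerProductSpace

/-- In a real inner product space, a point whose distances to `0` and `d` are at most `c * ‖d‖` and
`(1 - c) * ‖d‖` is `c • d`. -/
theorem eq_smul_of_norm_le_of_norm_sub_le {H : Type*} [NormedAddCommGroup H]
    [InnerProductSpace ℝ H] {p d : H} {c : ℝ} (hc0 : 0 ≤ c) (hc1 : c ≤ 1)
    (hp : ‖p‖ ≤ c * ‖d‖) (hpd : ‖p - d‖ ≤ (1 - c) * ‖d‖) : p = c • d := by
  have h1 : ‖p‖ ^ 2 ≤ (c * ‖d‖) ^ 2 := by gcongr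
  have h2 : ‖p - d‖ ^ 2 ≤ ((1 - c) * ‖d‖) ^ 2 := by gcongr
  have h3 : ‖p - c • d‖ ^ 2 = (1 - c) * ‖p‖ ^ 2 + c * ‖p - d‖ ^ 2 - c * (1 - c) * ‖d‖ ^ 2 := by
    rw [norm_sub_sq_real, norm_sub_sq_real, real_inner_smul_right, norm_smul, mul_pow,
      Real.norm_eq_abs, sq_abs]
    ring
  have h4 : ‖p - c • d‖ ^ 2 ≤ 0 := by
    rw [h3]
    linarith [mul_le_mul_of_nonneg_left h1 (sub_nonneg.2 hc1), mul_le_mul_of_nonneg_left h2 hc0]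
  exact sub_eq_zero.1 (norm_eq_zero.1 (pow_eq_zero_iff two_ne_zero |>.1
    (le_antisymm h4 (sq_nonneg _))))

theorem stmt1
    {H : Type*} [NormedAddCommGroup H] [InnerProductSpace ℝ H] [CompleteSpace H]
    (K : Set H) (hKclosed : IsClosed K) (hKconvex : Convex ℝ K)
    (hKcone : ∀ (α : ℝ), 0 ≤ α → ∀ x ∈ K, α • x ∈ K)
    (hKpointed : K ∩ (-K) = {0})
    (J : Set ℝ) (hJpos : ∀ u ∈ J, (0:ℝ) ≤ u) (hJ0 : (0:ℝ) ∈ J)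
    (hJadd : ∀ u ∈ J, ∀ v ∈ J, u + v ∈ J)
    (hJunbdd : ∀ M : ℝ, ∃ u ∈ J, M < u)
    (C : Set H) (hCne : C.Nonempty) (hCbdd : Bornology.IsBounded C)
    (hCclosed : IsClosed C) (hCconvex : Convex ℝ C)
    (T : ℝ → H → H)
    (hTself : ∀ u ∈ J, ∀ x ∈ C, T u x ∈ C)
    (hT0 : ∀ x ∈ C, T 0 x = x)
    (hTsemi : ∀ u ∈ J, ∀ v ∈ J, ∀ x ∈ C, T (u + v) x = T u (T v x))
    (hTcont : ∀ x ∈ C, ContinuousOn (fun u => T u x) J)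
    (hTmono : ∀ u ∈ J, ∀ x ∈ C, ∀ y ∈ C, y - x ∈ K → T u y - T u x ∈ K)
    (hTnonexp : ∀ u ∈ J, ∀ x ∈ C, ∀ y ∈ C, (y - x ∈ K ∨ x - y ∈ K) →
      ‖T u x - T u y‖ ≤ ‖x - y‖)
    (z1 z2 : H) (hz1 : z1 ∈ C) (hz2 : z2 ∈ C)
    (hz1fix : ∀ u ∈ J, T u z1 = z1) (hz2fix : ∀ u ∈ J, T u z2 = z2)
    (hord : z2 - z1 ∈ K) :
    ∀ c ∈ Set.Icc (0:ℝ) 1,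
      ((1 - c) • z1 + c • z2) ∈ C ∧
      ∀ u ∈ J, T u ((1 - c) • z1 + c • z2) = (1 - c) • z1 + c • z2 := by
  rintro c ⟨hc0, hc1⟩
  have hzC : (1 - c) • z1 + c • z2 ∈ C := hCconvex hz1 hz2 (sub_nonneg.2 hc1) hc0 (by ring)
  refine ⟨hzC, fun u hu => ?_⟩
  set z := (1 - c) • z1 + c • z2 with hz
  have e1 : z - z1 = c • (z2 - z1) := by rw [hz]; module
  have e2 : z2 - z = (1 - c) • (z2 - z1) := by rw [hz]; module
  have n1 := hTnonexp u hu z hzC z1 hz1 (Or.inr (e1 ▸ hKcone c hc0 _ hord))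
  have n2 := hTnonexp u hu z hzC z2 hz2
    (Or.inl (e2 ▸ hKcone (1 - c) (sub_nonneg.2 hc1) _ hord))
  rw [hz1fix u hu, e1, norm_smul, Real.norm_of_nonneg hc0] at n1
  rw [hz2fix u hu, norm_sub_rev z, e2, norm_smul, Real.norm_of_nonneg (sub_nonneg.2 hc1)] at n2
  have key := eq_smul_of_norm_le_of_norm_sub_le hc0 hc1 n1 (by rwa [sub_sub_sub_cancel_right])
  exact sub_left_injective (key.trans e1.symm)
end

section
/- If each T_t is nonexpansive on all of C (‖T_t x − T_t y‖ ≤ ‖x − y‖ for all x, y ∈ C, not merely for comparable pairs), then the common fixed point set Fix(Γ) is nonempty, closed, and convex. -/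
open Filter Topology RealInnerProductSpace

theorem norm_sub_convex_combination_sq {H : Type*} [NormedAddCommGroup H]
    [InnerProductSpace ℝ H] (w x y : H) {a b : ℝ} (hab : a + b = 1) :
    ‖w - (a • x + b • y)‖ ^ 2 =
      a * ‖w - x‖ ^ 2 + b * ‖w - y‖ ^ 2 - a * b * ‖x - y‖ ^ 2 := by
  have h1 : w - (a • x + b • y) = a • (w - x) + b • (w - y) := by
    have hw : w = a • w + b • w := by rw [← add_smul, hab, one_smul]
    nth_rewrite 1 [hw]
    module
  have h2 : x - y = (w - y) - (w - x) := by abel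
  rw [h1, h2, norm_add_sq_real, norm_sub_sq_real (w - y) (w - x), norm_smul, norm_smul, mul_pow,
    mul_pow, inner_smul_left, inner_smul_right, real_inner_comm (w - x) (w - y)]
  simp only [Real.norm_eq_abs, sq_abs, conj_trivial]
  obtain rfl : b = 1 - a := by linarith
  ring

theorem fixed_of_nearby_almost_fixed {H : Type*} [NormedAddCommGroup H] {C : Set H}
    {f : H → H} (hf : ∀ x ∈ C, ∀ y ∈ C, ‖f x - f y‖ ≤ ‖x - y‖) {x : H} (hx : x ∈ C)
    (h : ∀ ε > 0, ∃ y ∈ C, ‖x - y‖ ≤ ε ∧ ‖f y - y‖ ≤ ε) : f x = x := by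
  rw [← sub_eq_zero, ← norm_le_zero_iff]
  refine le_of_forall_pos_le_add fun ε hε => ?_
  obtain ⟨y, hy, hxy, hfy⟩ := h (ε / 3) (by positivity)
  have h1 := hf x hx y hy
  have h2 : ‖f x - x‖ ≤ ‖f x - f y‖ + ‖f y - x‖ := norm_sub_le_norm_sub_add_norm_sub _ _ _
  have h3 : ‖f y - x‖ ≤ ‖f y - y‖ + ‖y - x‖ := norm_sub_le_norm_sub_add_norm_sub _ _ _
  rw [norm_sub_rev y x] at h3
  linarith

/-- The points of `C` whose squared distance to some tail of the orbit of `x₀` is at most `R`. -/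
def asymptoticSublevel {H : Type*} [NormedAddCommGroup H] (J : Set ℝ) (C : Set H)
    (T : ℝ → H → H) (x₀ : H) (R : ℝ) : Set H :=
  {x ∈ C | ∃ t ∈ J, ∀ s ∈ J, ‖T (t + s) x₀ - x‖ ^ 2 ≤ R}

theorem midpoint_mem_asymptoticSublevel {H : Type*} [NormedAddCommGroup H]
    [InnerProductSpace ℝ H] {J : Set ℝ} (hJadd : ∀ u ∈ J, ∀ v ∈ J, u + v ∈ J) {C : Set H}
    (hC : Convex ℝ C) {T : ℝ → H → H} {x₀ x y : H} {R : ℝ}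
    (hx : x ∈ asymptoticSublevel J C T x₀ R) (hy : y ∈ asymptoticSublevel J C T x₀ R) :
    (1 / 2 : ℝ) • x + (1 / 2 : ℝ) • y ∈
      asymptoticSublevel J C T x₀ (R - ‖x - y‖ ^ 2 / 4) := by
  obtain ⟨hxC, t, ht, hxt⟩ := hx
  obtain ⟨hyC, t', ht', hyt⟩ := hy
  refine ⟨hC hxC hyC (by norm_num) (by norm_num) (by norm_num), t + t', hJadd t ht t' ht',
    fun s hs => ?_⟩
  have h1 := hxt (t' + s) (hJadd t' ht' s hs)
  have h2 := hyt (t + s) (hJadd t ht s hs)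
  rw [← add_assoc] at h1
  rw [← add_assoc, add_comm t' t] at h2
  rw [norm_sub_convex_combination_sq _ _ _ (by norm_num)]
  linarith

theorem map_mem_asymptoticSublevel {H : Type*} [NormedAddCommGroup H] {J : Set ℝ}
    (hJadd : ∀ u ∈ J, ∀ v ∈ J, u + v ∈ J) {C : Set H} {T : ℝ → H → H}
    (hTself : ∀ u ∈ J, ∀ x ∈ C, T u x ∈ C)
    (hTsemi : ∀ u ∈ J, ∀ v ∈ J, ∀ x ∈ C, T (u + v) x = T u (T v x))
    (hTnonexp : ∀ u ∈ J, ∀ x ∈ C, ∀ y ∈ C, ‖T u x - T u y‖ ≤ ‖x - y‖)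
    {x₀ x : H} (hx₀ : x₀ ∈ C) {R u : ℝ} (hu : u ∈ J)
    (hx : x ∈ asymptoticSublevel J C T x₀ R) : T u x ∈ asymptoticSublevel J C T x₀ R := by
  obtain ⟨hxC, t, ht, hxt⟩ := hx
  refine ⟨hTself u hu x hxC, u + t, hJadd u hu t ht, fun s hs => ?_⟩
  have hts := hJadd t ht s hs
  rw [add_assoc, hTsemi u hu _ hts x₀ hx₀]
  refine le_trans ?_ (hxt s hs)
  gcongr
  exact hTnonexp u hu _ (hTself _ hts x₀ hx₀) x hxC

theorem exists_common_fixedPoint {H : Type*} [NormedAddCommGroup H] [InnerProductSpace ℝ H]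
    [CompleteSpace H] {J : Set ℝ} (hJne : J.Nonempty)
    (hJadd : ∀ u ∈ J, ∀ v ∈ J, u + v ∈ J) {C : Set H} (hCne : C.Nonempty)
    (hCbdd : Bornology.IsBounded C) (hCclosed : IsClosed C) (hCconvex : Convex ℝ C)
    {T : ℝ → H → H} (hTself : ∀ u ∈ J, ∀ x ∈ C, T u x ∈ C)
    (hTsemi : ∀ u ∈ J, ∀ v ∈ J, ∀ x ∈ C, T (u + v) x = T u (T v x))
    (hTnonexp : ∀ u ∈ J, ∀ x ∈ C, ∀ y ∈ C, ‖T u x - T u y‖ ≤ ‖x - y‖) :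
    ∃ x ∈ C, ∀ u ∈ J, T u x = x := by
  obtain ⟨x₀, hx₀⟩ := hCne
  obtain ⟨t₀, ht₀⟩ := hJne
  set S := asymptoticSublevel J C T x₀
  set A : Set ℝ := {R | (S R).Nonempty}
  have hAbdd : BddBelow A := by
    refine ⟨0, ?_⟩
    rintro R ⟨x, -, t, ht, hxt⟩
    exact (sq_nonneg _).trans (hxt t ht)
  have hAne : A.Nonempty := by
    obtain ⟨K, hK⟩ := Metric.isBounded_iff.1 hCbdd
    refine ⟨K ^ 2, x₀, hx₀, t₀, ht₀, fun s hs => ?_⟩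
    have := hK (hTself _ (hJadd t₀ ht₀ s hs) x₀ hx₀) hx₀
    rw [dist_eq_norm] at this
    gcongr
  have hdiam : ∀ ε x y, x ∈ S (sInf A + ε ^ 2) → y ∈ S (sInf A + ε ^ 2) → 0 ≤ ε →
      ‖x - y‖ ≤ 2 * ε := by
    intro ε x y hx hy hε
    have h := csInf_le hAbdd
      (show _ ∈ A from ⟨_, midpoint_mem_asymptoticSublevel hJadd hCconvex hx hy⟩)
    refine le_of_sq_le_sq ?_ (by positivity)
    linarith
  have hmono : ∀ {R R'}, R ≤ R' → S R ⊆ S R' := by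
    rintro R R' h x ⟨hxC, t, ht, hxt⟩
    exact ⟨hxC, t, ht, fun s hs => (hxt s hs).trans h⟩
  have hne : ∀ n : ℕ, (S (sInf A + (1 / ((n : ℝ) + 1)) ^ 2)).Nonempty := by
    intro n
    obtain ⟨R, hR, hlt⟩ := exists_lt_of_csInf_lt hAne
      (lt_add_of_pos_right (sInf A) (by positivity : 0 < (1 / ((n : ℝ) + 1)) ^ 2))
    exact hR.mono (hmono hlt.le)
  choose x hx using hne
  have hlim : Tendsto (fun n : ℕ => 2 * (1 / ((n : ℝ) + 1))) atTop (𝓝 0) := by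
    simpa using (tendsto_one_div_add_atTop_nhds_zero_nat (𝕜 := ℝ)).const_mul 2
  have hcauchy : CauchySeq x := by
    refine cauchySeq_of_le_tendsto_0 _ (fun n m N hn hm => ?_) hlim
    have hN : ∀ k, N ≤ k → x k ∈ S (sInf A + (1 / ((N : ℝ) + 1)) ^ 2) := fun k hk =>
      hmono (by gcongr) (hx k)
    rw [dist_eq_norm]
    exact hdiam _ _ _ (hN n hn) (hN m hm) (by positivity)
  obtain ⟨z, hz⟩ := cauchySeq_tendsto_of_complete hcauchy
  have hzC : z ∈ C := hCclosed.mem_of_tendsto hz (Eventually.of_forall fun n => (hx n).1)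
  refine ⟨z, hzC, fun u hu => fixed_of_nearby_almost_fixed (hTnonexp u hu) hzC fun ε hε => ?_⟩
  obtain ⟨n, hn, hn'⟩ :=
    ((hlim.eventually_lt_const hε).and (Metric.tendsto_nhds.1 hz ε hε)).exists
  refine ⟨x n, (hx n).1, ?_, ?_⟩
  · rw [← dist_eq_norm, dist_comm]
    exact hn'.le
  · exact (hdiam _ _ _ (map_mem_asymptoticSublevel hJadd hTself hTsemi hTnonexp hx₀ hu (hx n))
      (hx n) (by positivity)).trans hn.le

theorem fixed_convex_combination {H : Type*} [NormedAddCommGroup H] [InnerProductSpace ℝ H]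
    {C : Set H} (hC : Convex ℝ C) {f : H → H}
    (hf : ∀ x ∈ C, ∀ y ∈ C, ‖f x - f y‖ ≤ ‖x - y‖) {x y : H} (hx : x ∈ C) (hy : y ∈ C)
    (hfx : f x = x) (hfy : f y = y) {a b : ℝ} (ha : 0 ≤ a) (hb : 0 ≤ b) (hab : a + b = 1) :
    f (a • x + b • y) = a • x + b • y := by
  set z := a • x + b • y with hz
  have hzC : z ∈ C := hC hx hy ha hb hab
  have h1 := hf z hzC x hx
  have h2 := hf z hzC y hy
  rw [hfx] at h1
  rw [hfy] at h2
  have h3 := norm_sub_convex_combination_sq (f z) x y hab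
  have h4 := norm_sub_convex_combination_sq z x y hab
  rw [← hz] at h3 h4
  rw [sub_self, norm_zero] at h4
  have h5 : a * ‖f z - x‖ ^ 2 ≤ a * ‖z - x‖ ^ 2 := by gcongr
  have h6 : b * ‖f z - y‖ ^ 2 ≤ b * ‖z - y‖ ^ 2 := by gcongr
  have h7 : ‖f z - z‖ ^ 2 = 0 := le_antisymm (by linarith) (sq_nonneg _)
  simpa [sub_eq_zero] using h7

theorem stmt2
    {H : Type*} [NormedAddCommGroup H] [InnerProductSpace ℝ H] [CompleteSpace H]
    (J : Set ℝ) (hJpos : ∀ u ∈ J, (0:ℝ) ≤ u) (hJ0 : (0:ℝ) ∈ J)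
    (hJadd : ∀ u ∈ J, ∀ v ∈ J, u + v ∈ J)
    (hJunbdd : ∀ M : ℝ, ∃ u ∈ J, M < u)
    (C : Set H) (hCne : C.Nonempty) (hCbdd : Bornology.IsBounded C)
    (hCclosed : IsClosed C) (hCconvex : Convex ℝ C)
    (T : ℝ → H → H)
    (hTself : ∀ u ∈ J, ∀ x ∈ C, T u x ∈ C)
    (hT0 : ∀ x ∈ C, T 0 x = x)
    (hTsemi : ∀ u ∈ J, ∀ v ∈ J, ∀ x ∈ C, T (u + v) x = T u (T v x))
    (hTcont : ∀ x ∈ C, ContinuousOn (fun u => T u x) J)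
    (hTnonexp : ∀ u ∈ J, ∀ x ∈ C, ∀ y ∈ C, ‖T u x - T u y‖ ≤ ‖x - y‖) :
    {x ∈ C | ∀ u ∈ J, T u x = x}.Nonempty ∧
    IsClosed {x ∈ C | ∀ u ∈ J, T u x = x} ∧
    Convex ℝ {x ∈ C | ∀ u ∈ J, T u x = x} := by
  refine ⟨exists_common_fixedPoint ⟨0, hJ0⟩ hJadd hCne hCbdd hCclosed hCconvex hTself hTsemi
    hTnonexp, isClosed_of_closure_subset fun x hx => ?_, ?_⟩
  · have hxC : x ∈ C := closure_minimal (fun _ h => h.1) hCclosed hx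
    refine ⟨hxC, fun u hu => fixed_of_nearby_almost_fixed (hTnonexp u hu) hxC fun ε hε => ?_⟩
    obtain ⟨y, hy, hxy⟩ := Metric.mem_closure_iff.1 hx ε hε
    rw [dist_eq_norm] at hxy
    exact ⟨y, hy.1, hxy.le, by simpa [hy.2 u hu] using hε.le⟩
  · intro x hx y hy a b ha hb hab
    exact ⟨hCconvex hx.1 hy.1 ha hb hab, fun u hu => fixed_convex_combination hCconvex
      (hTnonexp u hu) hx.1 hy.1 (hx.2 u hu) (hy.2 u hu) ha hb hab⟩
end

section
/- Let (X,d) be a complete metric space endowed with a partial order ⪯ such that whenever a ⪯-nondecreasing sequence (x^k) converges to x*, one has x^k ⪯ x* for all k. Let T : X → X be ⪯-nondecreasing (x ⪯ y implies Tx ⪯ Ty) and suppose there is L < 1 with d(Tx,Ty) ≤ L·d(x,y) whenever x and y are ⪯-comparable (x ⪯ y or y ⪯ x). If there exists x⁰ ∈ X with x⁰ ⪯ Tx⁰, then: T has a fixed point; the Picard orbit (Tᵏx⁰) converges to a fixed point w of T; and Tᵏx⁰ ⪯ w for all k ∈ ℕ. -/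
open Filter Topology RealInnerProductSpace

theorem stmt4
    {X : Type*} [MetricSpace X] [CompleteSpace X]
    (le : X → X → Prop)
    (hrefl : ∀ x, le x x)
    (hantisymm : ∀ x y, le x y → le y x → x = y)
    (htrans : ∀ x y z, le x y → le y z → le x z)
    (hordclosed : ∀ (x : ℕ → X) (xs : X), (∀ k, le (x k) (x (k + 1))) →
      Tendsto x atTop (𝓝 xs) → ∀ k, le (x k) xs)
    (T : X → X) (hmono : ∀ x y, le x y → le (T x) (T y))
    (L : ℝ) (hL : L < 1)
    (hLip : ∀ x y, (le x y ∨ le y x) → dist (T x) (T y) ≤ L * dist x y)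
    (x0 : X) (hx0 : le x0 (T x0)) :
    ∃ w, T w = w ∧ Tendsto (fun k => T^[k] x0) atTop (𝓝 w) ∧
      ∀ k : ℕ, le (T^[k] x0) w := by
  set K := max L 0
  have hK : K < 1 := max_lt hL one_pos
  have hLipK : ∀ x y, le x y → dist (T x) (T y) ≤ K * dist x y := fun x y h =>
    (hLip x y (Or.inl h)).trans (mul_le_mul_of_nonneg_right (le_max_left L 0) dist_nonneg)
  have hstep : ∀ k : ℕ, le (T^[k] x0) (T^[k + 1] x0) := by
    intro k
    induction k with
    | zero => exact hx0
    | succ k ih =>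
      rw [Function.iterate_succ_apply' T k, Function.iterate_succ_apply' T (k + 1)]
      exact hmono _ _ ih
  have hdist : ∀ k : ℕ, dist (T^[k] x0) (T^[k + 1] x0) ≤ dist x0 (T x0) * K ^ k := by
    intro k
    induction k with
    | zero => simp
    | succ k ih =>
      rw [Function.iterate_succ_apply' T k, Function.iterate_succ_apply' T (k + 1)]
      calc
        _ ≤ K * dist (T^[k] x0) (T^[k + 1] x0) := hLipK _ _ (hstep k)
        _ ≤ K * (dist x0 (T x0) * K ^ k) :=
          mul_le_mul_of_nonneg_left ih (le_max_right L 0)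
        _ = dist x0 (T x0) * K ^ (k + 1) := by ring
  obtain ⟨w, hw⟩ := cauchySeq_tendsto_of_complete (cauchySeq_of_le_geometric K _ hK hdist)
  have hle : ∀ k : ℕ, le (T^[k] x0) w := hordclosed _ w hstep hw
  refine ⟨w, ?_, hw, hle⟩
  have hTw : Tendsto (fun k => T^[k + 1] x0) atTop (𝓝 (T w)) := by
    refine tendsto_iff_dist_tendsto_zero.2 (squeeze_zero (fun _ => dist_nonneg)
      (fun k => ?_) (by simpa using (tendsto_iff_dist_tendsto_zero.1 hw).const_mul K))
    rw [Function.iterate_succ_apply']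
    exact hLipK _ _ (hle k)
  exact tendsto_nhds_unique hTw ((tendsto_add_atTop_iff_nat 1).2 hw)
end

section
/- If w ∈ Fix(Γ) satisfies x⁰ ⪯ w, then the real sequence (‖w − x^k‖) is nonincreasing, and in particular the limit lim_{k→∞} ‖w − x^k‖ exists. -/
open Filter Topology RealInnerProductSpace

theorem stmt6
    {H : Type*} [NormedAddCommGroup H] [InnerProductSpace ℝ H] [CompleteSpace H]
    (K : Set H) (hKclosed : IsClosed K) (hKconvex : Convex ℝ K)
    (hKcone : ∀ (α : ℝ), 0 ≤ α → ∀ x ∈ K, α • x ∈ K)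
    (hKpointed : K ∩ (-K) = {0})
    (J : Set ℝ) (hJpos : ∀ u ∈ J, (0:ℝ) ≤ u) (hJ0 : (0:ℝ) ∈ J)
    (hJadd : ∀ u ∈ J, ∀ v ∈ J, u + v ∈ J)
    (hJunbdd : ∀ M : ℝ, ∃ u ∈ J, M < u)
    (C : Set H) (hCne : C.Nonempty) (hCbdd : Bornology.IsBounded C)
    (hCclosed : IsClosed C) (hCconvex : Convex ℝ C)
    (T : ℝ → H → H)
    (hTself : ∀ u ∈ J, ∀ x ∈ C, T u x ∈ C)
    (hT0 : ∀ x ∈ C, T 0 x = x)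
    (hTsemi : ∀ u ∈ J, ∀ v ∈ J, ∀ x ∈ C, T (u + v) x = T u (T v x))
    (hTcont : ∀ x ∈ C, ContinuousOn (fun u => T u x) J)
    (hTmono : ∀ u ∈ J, ∀ x ∈ C, ∀ y ∈ C, y - x ∈ K → T u y - T u x ∈ K)
    (hTnonexp : ∀ u ∈ J, ∀ x ∈ C, ∀ y ∈ C, (y - x ∈ K ∨ x - y ∈ K) →
      ‖T u x - T u y‖ ≤ ‖x - y‖)
    (x0 : H) (hx0 : x0 ∈ C) (hx0le : ∀ u ∈ J, T u x0 - x0 ∈ K)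
    (lam : ℝ) (hlam : lam ∈ Set.Ioo (0:ℝ) 1)
    (t : ℕ → ℝ) (htJ : ∀ k, t k ∈ J) (htmono : StrictMono t)
    (htlim : Tendsto t atTop atTop)
    (x : ℕ → H) (hxinit : x 0 = x0)
    (hxrec : ∀ k, x (k + 1) = (1 - lam) • x k + lam • T (t k) (x k))
    (w : H) (hw : w ∈ C) (hwfix : ∀ u ∈ J, T u w = w) (hwge : w - x0 ∈ K) :
    Antitone (fun k => ‖w - x k‖) ∧
    ∃ l : ℝ, Tendsto (fun k => ‖w - x k‖) atTop (𝓝 l) := by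
  obtain ⟨hlam0, hlam1⟩ := hlam
  have hlam' : 0 ≤ 1 - lam := by linarith
  have hstep : ∀ k, w - x (k + 1) = (1 - lam) • (w - x k) + lam • (w - T (t k) (x k)) := by
    intro k
    rw [hxrec k]
    module
  have hTle : ∀ k, x k ∈ C → w - x k ∈ K → w - T (t k) (x k) ∈ K := by
    intro k hxC hxw
    simpa only [hwfix _ (htJ k)] using hTmono _ (htJ k) _ hxC _ hw hxw
  have hbelow : ∀ k, x k ∈ C ∧ w - x k ∈ K := by
    intro k
    induction k with
    | zero => exact hxinit ▸ ⟨hx0, hwge⟩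
    | succ k ih =>
      obtain ⟨hxC, hxw⟩ := ih
      constructor
      · rw [hxrec k]
        exact hCconvex hxC (hTself _ (htJ k) _ hxC) hlam' hlam0.le (by ring)
      · rw [hstep k]
        exact hKconvex hxw (hTle k hxC hxw) hlam' hlam0.le (by ring)
  have hanti : Antitone (fun k => ‖w - x k‖) := by
    refine antitone_nat_of_succ_le fun k => ?_
    obtain ⟨hxC, hxw⟩ := hbelow k
    have hT : ‖w - T (t k) (x k)‖ ≤ ‖w - x k‖ := by
      simpa only [hwfix _ (htJ k)] using hTnonexp _ (htJ k) _ hw _ hxC (Or.inr hxw)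
    calc ‖w - x (k + 1)‖
        ≤ ‖(1 - lam) • (w - x k)‖ + ‖lam • (w - T (t k) (x k))‖ := by
          rw [hstep k]
          exact norm_add_le _ _
      _ = (1 - lam) * ‖w - x k‖ + lam * ‖w - T (t k) (x k)‖ := by
          rw [norm_smul_of_nonneg hlam', norm_smul_of_nonneg hlam0.le]
      _ ≤ (1 - lam) * ‖w - x k‖ + lam * ‖w - x k‖ := by gcongr
      _ = ‖w - x k‖ := by ring
  refine ⟨hanti, _, tendsto_atTop_ciInf hanti ⟨0, ?_⟩⟩
  rintro _ ⟨k, rfl⟩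
  exact norm_nonneg _
end

section
/- The Krasnosel'skiĭ sequence (x^k) satisfies lim_{k→∞} ‖x^k − T_{t_k} x^k‖ = 0 and lim_{k→∞} ‖x^k − x^{k+1}‖ = 0. -/
open Filter Topology RealInnerProductSpace

/-- In a Hilbert space, a uniformly bounded directed family of nonempty closed convex sets
has nonempty intersection. -/
theorem nonempty_iInter_of_directed_of_convex
    {H : Type*} [NormedAddCommGroup H] [InnerProductSpace ℝ H] [CompleteSpace H]
    {ι : Type*} [Nonempty ι] (D : ι → Set H) (hdir : Directed (· ⊇ ·) D)
    (hne : ∀ i, (D i).Nonempty) (hclosed : ∀ i, IsClosed (D i)) (hconvex : ∀ i, Convex ℝ (D i))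
    {R : ℝ} (hR : ∀ i, ∀ y ∈ D i, ‖y‖ ≤ R) : (⋂ i, D i).Nonempty := by
  let : Preorder ι := Preorder.lift (fun i => OrderDual.toDual (D i))
  have hanti : ∀ {i j : ι}, i ≤ j → D j ⊆ D i := fun h => h
  have : IsDirectedOrder ι := ⟨hdir⟩
  have hmin : ∀ i, ∃ p ∈ D i, ∀ y ∈ D i, ‖p‖ ≤ ‖y‖ := by
    intro i
    obtain ⟨p, hp, hpeq⟩ :=
      exists_norm_eq_iInf_of_complete_convex (hne i) (hclosed i).isComplete (hconvex i) 0
    refine ⟨p, hp, fun y hy => ?_⟩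
    have hbdd : BddBelow (Set.range fun w : D i => ‖(0 : H) - w‖) :=
      ⟨0, by rintro _ ⟨w, rfl⟩; exact norm_nonneg _⟩
    have := ciInf_le hbdd ⟨y, hy⟩
    rw [← hpeq] at this
    simpa using this
  choose p hp hpmin using hmin
  have hbdd : BddAbove (Set.range fun i => ‖p i‖ ^ 2) := by
    refine ⟨R ^ 2, ?_⟩
    rintro _ ⟨i, rfl⟩
    exact pow_le_pow_left₀ (norm_nonneg _) (hR i _ (hp i)) 2
  have hcauchy : Cauchy (map p atTop) := by
    rw [Metric.cauchy_iff]
    refine ⟨inferInstance, fun ε hε => ?_⟩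
    obtain ⟨i, hi⟩ := exists_lt_of_lt_ciSup
      (show (⨆ i, ‖p i‖ ^ 2) - ε ^ 2 / 8 < ⨆ i, ‖p i‖ ^ 2 by linarith [sq_pos_of_pos hε])
    have hclose : ∀ j, i ≤ j → ‖p j - p i‖ < ε / 2 := by
      intro j hij
      have hmid : (1 / 2 : ℝ) • p i + (1 / 2 : ℝ) • p j ∈ D i :=
        hconvex i (hp i) (hanti hij (hp j)) (by norm_num) (by norm_num) (by norm_num)
      have h1 := pow_le_pow_left₀ (norm_nonneg _) (hpmin i _ hmid) 2
      rw [← smul_add, norm_smul, mul_pow] at h1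
      have h2 := parallelogram_law_with_norm ℝ (p j) (p i)
      have h3 : ‖p j‖ ^ 2 ≤ ⨆ i, ‖p i‖ ^ 2 := le_ciSup hbdd j
      rw [add_comm (p i)] at h1
      norm_num at h1
      refine lt_of_pow_lt_pow_left₀ 2 (by positivity) ?_
      nlinarith
    refine ⟨p '' Set.Ici i, image_mem_map (Ici_mem_atTop i), ?_⟩
    rintro _ ⟨j, hj, rfl⟩ _ ⟨k, hk, rfl⟩
    calc dist (p j) (p k) ≤ dist (p j) (p i) + dist (p k) (p i) := dist_triangle_right _ _ _
      _ < ε := by rw [dist_eq_norm, dist_eq_norm]; linarith [hclose j hj, hclose k hk]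
  obtain ⟨z, hz⟩ := CompleteSpace.complete hcauchy
  refine ⟨z, Set.mem_iInter.2 fun i => (hclosed i).mem_of_tendsto (f := p) (b := atTop) hz ?_⟩
  filter_upwards [Ici_mem_atTop i] with j hj using hanti hj (hp j)

/-- Existence of an asymptotic center `z`, with its uniqueness property, of a bounded net
indexed by a commutative monoid, relative to a closed convex bounded set. -/
theorem exists_asymptotic_center_s7
    {H : Type*} [NormedAddCommGroup H] [InnerProductSpace ℝ H] [CompleteSpace H]
    {M : Type*} [AddCommMonoid M] (u : M → H) {B : ℝ} (hu : ∀ v, ‖u v‖ ≤ B)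
    {P : Set H} (hne : P.Nonempty) (hclosed : IsClosed P) (hconvex : Convex ℝ P)
    {R : ℝ} (hR : ∀ y ∈ P, ‖y‖ ≤ R) :
    ∃ z ∈ P, ∀ w ∈ P,
      (∀ c s, (∀ v, ‖u (s + v) - z‖ ≤ c) → ∃ s', ∀ v, ‖u (s' + v) - w‖ ≤ c) → w = z := by
  set A : ℝ → Set H := fun c => {y | y ∈ P ∧ ∃ s, ∀ v, ‖u (s + v) - y‖ ≤ c}
  have hmono : ∀ {c c'}, c ≤ c' → A c ⊆ A c' := by
    rintro c c' h y ⟨hy, s, hs⟩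
    exact ⟨hy, s, fun v => (hs v).trans h⟩
  have hAconvex : ∀ c, Convex ℝ (A c) := by
    rintro c y ⟨hy, s, hs⟩ y' ⟨hy', s', hs'⟩ a b ha hb hab
    refine ⟨hconvex hy hy' ha hb hab, s + s', fun v => ?_⟩
    have h1 := hs (s' + v)
    have h2 := hs' (s + v)
    rw [← add_assoc, ← mem_closedBall_iff_norm'] at h1 h2
    rw [add_comm s' s] at h2
    rw [← mem_closedBall_iff_norm']
    exact convex_closedBall _ _ h1 h2 ha hb hab
  have hAclosure : ∀ {c c'}, c < c' → closure (A c) ⊆ A c' := by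
    intro c c' h y hy
    obtain ⟨y', ⟨-, s, hs⟩, hyy'⟩ := Metric.mem_closure_iff.1 hy (c' - c) (by linarith)
    refine ⟨closure_minimal (fun _ h => h.1) hclosed hy, s, fun v => ?_⟩
    have := norm_sub_le_norm_sub_add_norm_sub (u (s + v)) y' y
    rw [dist_comm, dist_eq_norm] at hyy'
    linarith [hs v]
  set ρ := sInf {c | (A c).Nonempty}
  have hbdd : BddBelow {c | (A c).Nonempty} := by
    refine ⟨0, ?_⟩
    rintro c ⟨y, -, s, hs⟩
    exact (norm_nonneg _).trans (hs 0)
  have hnonempty : {c | (A c).Nonempty}.Nonempty := by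
    obtain ⟨y, hy⟩ := hne
    exact ⟨B + ‖y‖, y, hy, 0, fun v => (norm_sub_le _ _).trans (by linarith [hu (0 + v)])⟩
  have hAne : ∀ c, ρ < c → (A c).Nonempty := by
    intro c hc
    obtain ⟨c', hc', hlt⟩ := exists_lt_of_csInf_lt hnonempty hc
    exact Set.Nonempty.mono (hmono hlt.le) hc'
  have hρ0 : 0 ≤ ρ := by
    refine le_csInf hnonempty ?_
    rintro c ⟨y, -, s, hs⟩
    exact (norm_nonneg _).trans (hs 0)
  have : Nonempty (Set.Ioi ρ) := ⟨⟨ρ + 1, by simp⟩⟩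
  obtain ⟨z, hz⟩ := nonempty_iInter_of_directed_of_convex
    (fun c : Set.Ioi ρ => closure (A c))
    (directed_of_isDirected_ge fun c c' h => closure_mono (hmono h))
    (fun c => (hAne c c.2).closure) (fun _ => isClosed_closure) (fun c => (hAconvex c).closure)
    (R := R) (fun c y hy => hR y (closure_minimal (fun _ h => h.1) hclosed hy))
  have hzA : ∀ c, ρ < c → z ∈ A c := by
    intro c hc
    obtain ⟨c', h1, h2⟩ := exists_between hc
    exact hAclosure h2 (Set.mem_iInter.1 hz ⟨c', h1⟩)
  refine ⟨z, (hzA (ρ + 1) (by linarith)).1, fun w hw hwz => ?_⟩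
  by_contra hne'
  have hd : 0 < ‖z - w‖ ^ 2 := by
    have := norm_pos_iff.2 (sub_ne_zero.2 (Ne.symm hne'))
    positivity
  obtain ⟨c, hc, hc2⟩ : ∃ c, ρ < c ∧ c ^ 2 - ‖z - w‖ ^ 2 / 4 < ρ ^ 2 := by
    refine ⟨√(ρ ^ 2 + ‖z - w‖ ^ 2 / 8), Real.lt_sqrt_of_sq_lt (by linarith), ?_⟩
    rw [Real.sq_sqrt (by positivity)]
    linarith
  obtain ⟨hzP, s, hs⟩ := hzA c hc
  obtain ⟨s', hs'⟩ := hwz c s hs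
  have hmid : ∀ v, ‖u (s + s' + v) - ((1 / 2 : ℝ) • z + (1 / 2 : ℝ) • w)‖ ^ 2
      ≤ c ^ 2 - ‖z - w‖ ^ 2 / 4 := by
    intro v
    have h1 := hs (s' + v)
    have h2 := hs' (s + v)
    rw [← add_assoc] at h1 h2
    rw [add_comm s' s] at h2
    set a := u (s + s' + v)
    have h3 := parallelogram_law_with_norm ℝ (a - z) (a - w)
    have h4 : a - ((1 / 2 : ℝ) • z + (1 / 2 : ℝ) • w) = (1 / 2 : ℝ) • ((a - z) + (a - w)) := by
      module
    have h5 : a - z - (a - w) = -(z - w) := by abel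
    rw [h5, norm_neg] at h3
    rw [h4, norm_smul, mul_pow]
    have h6 := pow_le_pow_left₀ (norm_nonneg _) h1 2
    have h7 := pow_le_pow_left₀ (norm_nonneg _) h2 2
    norm_num
    nlinarith
  have hle : ρ ≤ √(c ^ 2 - ‖z - w‖ ^ 2 / 4) :=
    csInf_le hbdd ⟨_, hconvex hzP hw (by norm_num) (by norm_num) (by norm_num), s + s',
      fun v => Real.le_sqrt_of_sq_le (hmid v)⟩
  have hsq := pow_le_pow_left₀ hρ0 hle 2
  rw [Real.sq_sqrt ((sq_nonneg _).trans (hmid 0))] at hsq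
  linarith

/-- A commutative semigroup of order-preserving maps that are nonexpansive on comparable points
has a common fixed point above any `x₀` lying below its own orbit. -/
theorem exists_common_fixed_point_above
    {H : Type*} [NormedAddCommGroup H] [InnerProductSpace ℝ H] [CompleteSpace H]
    {M : Type*} [AddCommMonoid M]
    {K : Set H} (hKclosed : IsClosed K) (hKconvex : Convex ℝ K) (hK0 : (0 : H) ∈ K)
    (hKadd : ∀ x ∈ K, ∀ y ∈ K, x + y ∈ K)
    {C : Set H} (hCbdd : Bornology.IsBounded C) (hCclosed : IsClosed C) (hCconvex : Convex ℝ C)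
    (T : M → H → H) (hTself : ∀ s, ∀ x ∈ C, T s x ∈ C)
    (hT0 : ∀ x ∈ C, T 0 x = x)
    (hTsemi : ∀ s t, ∀ x ∈ C, T (s + t) x = T s (T t x))
    (hTmono : ∀ s, ∀ x ∈ C, ∀ y ∈ C, y - x ∈ K → T s y - T s x ∈ K)
    (hTnonexp : ∀ s, ∀ x ∈ C, ∀ y ∈ C, y - x ∈ K → ‖T s x - T s y‖ ≤ ‖x - y‖)
    {x₀ : H} (hx₀ : x₀ ∈ C) (hle : ∀ s, T s x₀ - x₀ ∈ K) :
    ∃ z ∈ C, z - x₀ ∈ K ∧ ∀ s, T s z = z := by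
  obtain ⟨R, hR⟩ := hCbdd.exists_norm_le
  have huC : ∀ t, T t x₀ ∈ C := fun t => hTself t _ hx₀
  have htrans : ∀ {a b c : H}, b - a ∈ K → c - b ∈ K → c - a ∈ K := by
    intro a b c h1 h2
    simpa using hKadd _ h2 _ h1
  have hshift : ∀ s t, T (s + t) x₀ - T s x₀ ∈ K := by
    intro s t
    rw [hTsemi s t _ hx₀]
    exact hTmono s _ hx₀ _ (huC t) (hle t)
  set D : M → Set H := fun t => C ∩ (fun y => y - T t x₀) ⁻¹' K
  have hDclosed : ∀ t, IsClosed (D t) := fun t =>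
    hCclosed.inter (hKclosed.preimage (by fun_prop))
  have hDconvex : ∀ t, Convex ℝ (D t) := by
    refine fun t => hCconvex.inter ?_
    simpa only [sub_eq_add_neg] using hKconvex.translate_preimage_left (-T t x₀)
  have hDanti : ∀ s t, D (s + t) ⊆ D s := fun s t y hy => ⟨hy.1, htrans (hshift s t) hy.2⟩
  have hDir : Directed (· ⊇ ·) D := fun s t =>
    ⟨s + t, hDanti s t, by rw [add_comm]; exact hDanti t s⟩
  have hDne := nonempty_iInter_of_directed_of_convex D hDir
    (fun t => ⟨T t x₀, huC t, by simpa using hK0⟩) hDclosed hDconvex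
    (fun t y hy => hR y hy.1)
  obtain ⟨z, hz, hcenter⟩ := exists_asymptotic_center_s7 (fun t => T t x₀)
    (fun t => hR _ (huC t)) hDne (isClosed_iInter hDclosed) (convex_iInter hDconvex)
    (fun y hy => hR y (Set.mem_iInter.1 hy 0).1)
  have hz' : ∀ t, z ∈ D t := Set.mem_iInter.1 hz
  have hzC : z ∈ C := (hz' 0).1
  refine ⟨z, hzC, by simpa [hT0 _ hx₀] using (hz' 0).2, fun s => hcenter _ ?_ ?_⟩
  · refine Set.mem_iInter.2 fun t => hDanti t s ⟨hTself s _ hzC, ?_⟩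
    simp only [Set.mem_preimage]
    rw [add_comm, hTsemi s t _ hx₀]
    exact hTmono s _ (huC t) _ hzC (hz' t).2
  · intro c r hr
    refine ⟨s + r, fun v => ?_⟩
    rw [add_assoc, hTsemi s _ _ hx₀]
    exact (hTnonexp s _ (huC _) _ hzC (hz' _).2).trans (hr v)

/-- The norm identity behind the Krasnoselskii iteration. -/
theorem norm_sq_convex_combination
    {H : Type*} [NormedAddCommGroup H] [InnerProductSpace ℝ H] (a b : H) (l : ℝ) :
    ‖(1 - l) • a + l • b‖ ^ 2
      = (1 - l) * ‖a‖ ^ 2 + l * ‖b‖ ^ 2 - l * (1 - l) * ‖a - b‖ ^ 2 := by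
  rw [norm_add_sq_real, norm_sub_sq_real, norm_smul, norm_smul, mul_pow, mul_pow,
    real_inner_smul_left, real_inner_smul_right, Real.norm_eq_abs, Real.norm_eq_abs, sq_abs,
    sq_abs]
  ring

theorem stmt7
    {H : Type*} [NormedAddCommGroup H] [InnerProductSpace ℝ H] [CompleteSpace H]
    (K : Set H) (hKclosed : IsClosed K) (hKconvex : Convex ℝ K)
    (hKcone : ∀ (α : ℝ), 0 ≤ α → ∀ x ∈ K, α • x ∈ K)
    (hKpointed : K ∩ (-K) = {0})
    (J : Set ℝ) (hJpos : ∀ u ∈ J, (0:ℝ) ≤ u) (hJ0 : (0:ℝ) ∈ J)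
    (hJadd : ∀ u ∈ J, ∀ v ∈ J, u + v ∈ J)
    (hJunbdd : ∀ M : ℝ, ∃ u ∈ J, M < u)
    (C : Set H) (hCne : C.Nonempty) (hCbdd : Bornology.IsBounded C)
    (hCclosed : IsClosed C) (hCconvex : Convex ℝ C)
    (T : ℝ → H → H)
    (hTself : ∀ u ∈ J, ∀ x ∈ C, T u x ∈ C)
    (hT0 : ∀ x ∈ C, T 0 x = x)
    (hTsemi : ∀ u ∈ J, ∀ v ∈ J, ∀ x ∈ C, T (u + v) x = T u (T v x))
    (hTcont : ∀ x ∈ C, ContinuousOn (fun u => T u x) J)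
    (hTmono : ∀ u ∈ J, ∀ x ∈ C, ∀ y ∈ C, y - x ∈ K → T u y - T u x ∈ K)
    (hTnonexp : ∀ u ∈ J, ∀ x ∈ C, ∀ y ∈ C, (y - x ∈ K ∨ x - y ∈ K) →
      ‖T u x - T u y‖ ≤ ‖x - y‖)
    (x0 : H) (hx0 : x0 ∈ C) (hx0le : ∀ u ∈ J, T u x0 - x0 ∈ K)
    (lam : ℝ) (hlam : lam ∈ Set.Ioo (0:ℝ) 1)
    (t : ℕ → ℝ) (htJ : ∀ k, t k ∈ J) (htmono : StrictMono t)
    (htlim : Tendsto t atTop atTop)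
    (x : ℕ → H) (hxinit : x 0 = x0)
    (hxrec : ∀ k, x (k + 1) = (1 - lam) • x k + lam • T (t k) (x k)) :
    Tendsto (fun k => ‖x k - T (t k) (x k)‖) atTop (𝓝 0) ∧
    Tendsto (fun k => ‖x k - x (k + 1)‖) atTop (𝓝 0) := by
  obtain ⟨hl0, hl1⟩ := hlam
  have hK0 : (0 : H) ∈ K := by
    have : (0 : H) ∈ K ∩ (-K) := by rw [hKpointed]; rfl
    exact this.1
  have hKadd : ∀ a ∈ K, ∀ b ∈ K, a + b ∈ K := by
    intro a ha b hb
    have hmid : (1 / 2 : ℝ) • a + (1 / 2 : ℝ) • b ∈ K :=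
      hKconvex ha hb (by norm_num) (by norm_num) (by norm_num)
    have := hKcone 2 (by norm_num) _ hmid
    rwa [show (2 : ℝ) • ((1 / 2 : ℝ) • a + (1 / 2 : ℝ) • b) = a + b by module] at this
  let M : AddSubmonoid ℝ :=
    { carrier := J, zero_mem' := hJ0, add_mem' := fun {u v} hu hv => hJadd u hu v hv }
  obtain ⟨z, hzC, hzK, hz⟩ := exists_common_fixed_point_above (M := M) hKclosed hKconvex hK0
    hKadd hCbdd hCclosed hCconvex (fun s => T s) (fun s => hTself s s.2) hT0
    (fun s r => hTsemi s s.2 r r.2) (fun s => hTmono s s.2)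
    (fun s a ha b hb hab => hTnonexp s s.2 a ha b hb (Or.inl hab)) hx0 (fun s => hx0le s s.2)
  have hzt : ∀ k, T (t k) z = z := fun k => hz ⟨t k, htJ k⟩
  have hinv : ∀ k, x k ∈ C ∧ z - x k ∈ K := by
    intro k
    induction k with
    | zero => rw [hxinit]; exact ⟨hx0, hzK⟩
    | succ k ih =>
      obtain ⟨hC, hle⟩ := ih
      have hTle := hTmono _ (htJ k) _ hC _ hzC hle
      rw [hzt k] at hTle
      rw [hxrec k]
      refine ⟨hCconvex hC (hTself _ (htJ k) _ hC) (by linarith) hl0.le (by ring), ?_⟩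
      have := hKconvex hle hTle (a := 1 - lam) (b := lam) (by linarith) hl0.le (by ring)
      convert this using 1
      module
  have hstep : ∀ k, lam * (1 - lam) * ‖x k - T (t k) (x k)‖ ^ 2
      ≤ ‖x k - z‖ ^ 2 - ‖x (k + 1) - z‖ ^ 2 := by
    intro k
    have hne := hTnonexp _ (htJ k) _ (hinv k).1 _ hzC (Or.inl (hinv k).2)
    rw [hzt k] at hne
    have hsq := pow_le_pow_left₀ (norm_nonneg _) hne 2
    have hid := norm_sq_convex_combination (x k - z) (T (t k) (x k) - z) lam
    rw [sub_sub_sub_cancel_right, show (1 - lam) • (x k - z) + lam • (T (t k) (x k) - z)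
      = x (k + 1) - z by rw [hxrec k]; module] at hid
    nlinarith
  have hpos : 0 < lam * (1 - lam) := mul_pos hl0 (by linarith)
  have hanti : Antitone fun k => ‖x k - z‖ ^ 2 := by
    refine antitone_nat_of_succ_le fun k => ?_
    have := hstep k
    have := mul_nonneg hpos.le (sq_nonneg ‖x k - T (t k) (x k)‖)
    linarith
  have hlim := tendsto_atTop_ciInf hanti ⟨0, by rintro _ ⟨k, rfl⟩; positivity⟩
  have hdiff := (hlim.sub (hlim.comp (tendsto_add_atTop_nat 1))).div_const (lam * (1 - lam))
  rw [sub_self, zero_div] at hdiff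
  have hsq : Tendsto (fun k => ‖x k - T (t k) (x k)‖ ^ 2) atTop (𝓝 0) := by
    refine squeeze_zero (fun k => sq_nonneg _) (fun k => ?_) hdiff
    rw [le_div_iff₀ hpos, mul_comm]
    exact hstep k
  have hmain : Tendsto (fun k => ‖x k - T (t k) (x k)‖) atTop (𝓝 0) := by
    simpa using hsq.sqrt
  refine ⟨hmain, ?_⟩
  have heq : ∀ k, ‖x k - x (k + 1)‖ = lam * ‖x k - T (t k) (x k)‖ := by
    intro k
    rw [hxrec k, show x k - ((1 - lam) • x k + lam • T (t k) (x k))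
      = lam • (x k - T (t k) (x k)) by module, norm_smul, Real.norm_of_nonneg hl0.le]
  simpa [heq] using hmain.const_mul lam
end

section
/- Suppose s ∈ J has the property that there exists a strictly increasing sequence (j_k) of positive integers such that t_{j_{k+1}} = s + t_{j_k} for all k ∈ ℕ, and assume moreover that sup_{k ∈ ℕ} (j_k − k) < ∞. Then: (i) lim_{k→∞} ‖x^k − x^{j_k}‖ = 0; and (ii) the full sequence (x^k) is an approximate fixed point sequence of T_s, i.e., lim_{k→∞} ‖x^k − T_s x^k‖ = 0. -/
open Filter Topology RealInnerProductSpace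

/-- Quantitative rigidity of the triangle inequality in an inner product space: if `c` is split as
`a + (c - a)` with norms asymptotically in proportion `α : 1 - α`, then `a` is asymptotically
`α • c`. -/
theorem tendsto_sub_smul_zero_of_norm_le {H : Type*} [NormedAddCommGroup H]
    [InnerProductSpace ℝ H] {α r : ℝ} (hα0 : 0 ≤ α) (hα1 : α ≤ 1) {a c : ℕ → H} {A B : ℕ → ℝ}
    (hc : Tendsto (fun k => ‖c k‖) atTop (𝓝 r))
    (haA : ∀ k, ‖a k‖ ≤ A k) (hA : Tendsto A atTop (𝓝 (α * r)))
    (hcB : ∀ k, ‖c k - a k‖ ≤ B k) (hB : Tendsto B atTop (𝓝 ((1 - α) * r))) :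
    Tendsto (fun k => a k - α • c k) atTop (𝓝 0) := by
  have key : ∀ k, ‖a k - α • c k‖ ^ 2
      ≤ (1 - α) * A k ^ 2 + α * B k ^ 2 - α * (1 - α) * ‖c k‖ ^ 2 := by
    intro k
    have h1 : ‖a k - α • c k‖ ^ 2
        = (1 - α) * ‖a k‖ ^ 2 + α * ‖c k - a k‖ ^ 2 - α * (1 - α) * ‖c k‖ ^ 2 := by
      rw [norm_sub_sq_real, norm_sub_sq_real, norm_smul, inner_smul_right, real_inner_comm,
        mul_pow, Real.norm_eq_abs, sq_abs]
      ring
    have h2 : ‖a k‖ ^ 2 ≤ A k ^ 2 := pow_le_pow_left₀ (norm_nonneg _) (haA k) 2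
    have h3 : ‖c k - a k‖ ^ 2 ≤ B k ^ 2 := pow_le_pow_left₀ (norm_nonneg _) (hcB k) 2
    rw [h1]
    have := mul_le_mul_of_nonneg_left h2 (sub_nonneg.2 hα1)
    have := mul_le_mul_of_nonneg_left h3 hα0
    linarith
  have hlim : Tendsto (fun k => (1 - α) * A k ^ 2 + α * B k ^ 2 - α * (1 - α) * ‖c k‖ ^ 2)
      atTop (𝓝 0) := by
    have := (((hA.pow 2).const_mul (1 - α)).add ((hB.pow 2).const_mul α)).sub
      ((hc.pow 2).const_mul (α * (1 - α)))
    convert this using 2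
    ring
  have hsq := squeeze_zero (fun k => sq_nonneg ‖a k - α • c k‖) key hlim
  rw [tendsto_zero_iff_norm_tendsto_zero]
  simpa [Real.sqrt_sq (norm_nonneg _)] using hsq.sqrt

/-- Existence, uniqueness and localisation of the asymptotic center of a bounded family in a
closed convex subset of a Hilbert space. -/
theorem exists_asymptotic_center_s9 {H ι : Type*} [NormedAddCommGroup H] [InnerProductSpace ℝ H]
    [CompleteSpace H] {l : Filter ι} [l.NeBot] {C : Set H} (hCclosed : IsClosed C)
    (hCconvex : Convex ℝ C) (hCbdd : Bornology.IsBounded C) {a : ι → H} (ha : ∀ᶠ u in l, a u ∈ C) :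
    ∃ p ∈ C, (∀ q ∈ C, (∀ ρ : ℝ, (∀ᶠ u in l, ‖a u - p‖ ≤ ρ) → ∀ᶠ u in l, ‖a u - q‖ ≤ ρ) → q = p) ∧
      ∀ S ⊆ C, IsClosed S → Convex ℝ S → (∀ᶠ u in l, a u ∈ S) → p ∈ S := by
  set A : Set ℝ := {ρ | ∃ z ∈ C, ∀ᶠ u in l, ‖a u - z‖ ≤ ρ}
  have hA0 : ∀ ρ ∈ A, 0 ≤ ρ := by
    rintro ρ ⟨z, -, hz⟩
    obtain ⟨u, hu⟩ := hz.exists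
    exact (norm_nonneg _).trans hu
  have hAbdd : BddBelow A := ⟨0, fun ρ hρ => hA0 ρ hρ⟩
  have hAne : A.Nonempty := by
    obtain ⟨u, hu⟩ := ha.exists
    obtain ⟨M, hM⟩ := Metric.isBounded_iff.1 hCbdd
    exact ⟨M, a u, hu, ha.mono fun v hv => by simpa [dist_eq_norm] using hM hv hu⟩
  set m := sInf A
  have hm0 : 0 ≤ m := le_csInf hAne hA0
  have hmid : ∀ z ∈ C, ∀ z' ∈ C, ∀ ρ : ℝ, (∀ᶠ u in l, ‖a u - z‖ ≤ ρ) →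
      (∀ᶠ u in l, ‖a u - z'‖ ≤ ρ) → ‖z - z'‖ ^ 2 ≤ 4 * (ρ ^ 2 - m ^ 2) := by
    intro z hz z' hz' ρ h h'
    have hsq : ∀ᶠ u in l, ‖a u - midpoint ℝ z z'‖ ^ 2 ≤ ρ ^ 2 - ‖z - z'‖ ^ 2 / 4 := by
      filter_upwards [h, h'] with u hu hu'
      have hpar := parallelogram_law_with_norm ℝ (a u - z) (a u - z')
      have e1 : (a u - z) + (a u - z') = (2 : ℝ) • (a u - midpoint ℝ z z') := by
        rw [midpoint_eq_smul_add, smul_sub, smul_smul, two_smul]; norm_num; abel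
      have e2 : (a u - z) - (a u - z') = -(z - z') := by abel
      rw [e1, e2, norm_neg, norm_smul, Real.norm_eq_abs, abs_two] at hpar
      have := pow_le_pow_left₀ (norm_nonneg _) hu 2
      have := pow_le_pow_left₀ (norm_nonneg _) hu' 2
      nlinarith
    have hmem : Real.sqrt (ρ ^ 2 - ‖z - z'‖ ^ 2 / 4) ∈ A :=
      ⟨midpoint ℝ z z', hCconvex.midpoint_mem hz hz', hsq.mono fun u hu => Real.le_sqrt_of_sq_le hu⟩
    obtain ⟨u, hu⟩ := hsq.exists
    have hle := csInf_le hAbdd hmem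
    have := (Real.le_sqrt hm0 ((sq_nonneg _).trans hu)).1 hle
    linarith
  have hex : ∀ n : ℕ, ∃ z ∈ C, ∀ᶠ u in l, ‖a u - z‖ ≤ m + 1 / ((n : ℝ) + 1) := by
    intro n
    obtain ⟨ρ, ⟨z, hz, hzρ⟩, hρ⟩ := exists_lt_of_csInf_lt hAne
      (lt_add_of_pos_right m (Nat.one_div_pos_of_nat (n := n) (α := ℝ)))
    exact ⟨z, hz, hzρ.mono fun u hu => hu.trans hρ.le⟩
  choose z hzC hz using hex
  have h1n := tendsto_one_div_add_atTop_nhds_zero_nat (𝕜 := ℝ)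
  have hgap : Tendsto (fun n : ℕ => Real.sqrt (4 * ((m + 1 / ((n : ℝ) + 1)) ^ 2 - m ^ 2)))
      atTop (𝓝 0) := by
    have := ((((h1n.const_add m).pow 2).sub_const (m ^ 2)).const_mul 4).sqrt
    simpa using this
  have hcauchy : CauchySeq z := by
    refine cauchySeq_of_le_tendsto_0 _ (fun n k N hn hk => ?_) hgap
    rw [dist_eq_norm]
    refine Real.le_sqrt_of_sq_le (hmid _ (hzC n) _ (hzC k) _ ?_ ?_)
    · exact (hz n).mono fun u hu => hu.trans (by gcongr)
    · exact (hz k).mono fun u hu => hu.trans (by gcongr)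
  obtain ⟨p, hp⟩ := cauchySeq_tendsto_of_complete hcauchy
  have hpC : p ∈ C := hCclosed.mem_of_tendsto hp (Eventually.of_forall hzC)
  have hpρ : ∀ ρ > m, ∀ᶠ u in l, ‖a u - p‖ ≤ ρ := by
    intro ρ hρ
    have hlim : Tendsto (fun n : ℕ => m + 1 / ((n : ℝ) + 1) + ‖z n - p‖) atTop (𝓝 m) := by
      simpa using (h1n.const_add m).add (tendsto_iff_norm_sub_tendsto_zero.1 hp)
    obtain ⟨n, hn⟩ := (hlim.eventually_lt_const hρ).exists
    filter_upwards [hz n] with u hu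
    linarith [norm_sub_le_norm_sub_add_norm_sub (a u) (z n) p]
  have huniq : ∀ q ∈ C,
      (∀ ρ : ℝ, (∀ᶠ u in l, ‖a u - p‖ ≤ ρ) → ∀ᶠ u in l, ‖a u - q‖ ≤ ρ) → q = p := by
    intro q hq h
    have hle : ∀ n : ℕ, ‖q - p‖ ≤ Real.sqrt (4 * ((m + 1 / ((n : ℝ) + 1)) ^ 2 - m ^ 2)) := by
      intro n
      have hρ := hpρ _ (lt_add_of_pos_right m (Nat.one_div_pos_of_nat (n := n) (α := ℝ)))
      exact Real.le_sqrt_of_sq_le (hmid _ hq _ hpC _ (h _ hρ) hρ)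
    exact sub_eq_zero.1 (norm_le_zero_iff.1 (ge_of_tendsto' hgap hle))
  refine ⟨p, hpC, huniq, fun S hSC hSclosed hSconvex hS => ?_⟩
  obtain ⟨q, hqS, hq⟩ := exists_norm_eq_iInf_of_complete_convex
    (hS.exists.elim fun u hu => ⟨a u, hu⟩) hSclosed.isComplete hSconvex p
  have hinner := (norm_eq_iInf_iff_real_inner_le_zero hSconvex hqS).1 hq
  have : q = p := by
    refine huniq q (hSC hqS) fun ρ hρ => ?_
    filter_upwards [hρ, hS] with u hu huS
    refine le_trans (le_of_sq_le_sq ?_ (norm_nonneg _)) hu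
    have e : a u - p = (a u - q) - (p - q) := by abel
    rw [e, norm_sub_sq_real (a u - q), real_inner_comm]
    linarith [hinner _ huS, sq_nonneg ‖p - q‖]
  exact this ▸ hqS

/-- Krasnosel'skii iteration along an arithmetic progression of times for a monotone nonexpansive
semigroup fixing the least element `0` of its domain. -/
theorem krasnoselskii_of_arithmetic {H : Type*} [NormedAddCommGroup H] [InnerProductSpace ℝ H]
    {K D : Set H} {J : Set ℝ} {S : ℝ → H → H} (hKcone : ∀ α : ℝ, 0 ≤ α → ∀ x ∈ K, α • x ∈ K)
    (hKadd : ∀ x ∈ K, ∀ y ∈ K, x + y ∈ K) (hDK : D ⊆ K) (hDconvex : Convex ℝ D) (hD0 : (0 : H) ∈ D)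
    (hSself : ∀ u ∈ J, ∀ x ∈ D, S u x ∈ D) (hS0 : ∀ u ∈ J, S u 0 = 0)
    (hSsemi : ∀ u ∈ J, ∀ v ∈ J, ∀ x ∈ D, S (u + v) x = S u (S v x))
    (hSmono : ∀ u ∈ J, ∀ x ∈ D, ∀ y ∈ D, y - x ∈ K → S u y - S u x ∈ K)
    (hSnonexp : ∀ u ∈ J, ∀ x ∈ D, ∀ y ∈ D, y - x ∈ K → ‖S u y - S u x‖ ≤ ‖y - x‖)
    {lam : ℝ} (hlam0 : 0 < lam) (hlam1 : lam < 1) {s : ℝ} (hs : s ∈ J)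
    {t : ℕ → ℝ} (htJ : ∀ k, t k ∈ J) (ht : ∀ k, t (k + 1) = s + t k)
    {z : ℕ → H} (hzD : ∀ k, z k ∈ D)
    (hz : ∀ k, z (k + 1) = (1 - lam) • z k + lam • S (t k) (z k)) :
    Tendsto (fun k => z (k + 1) - z k) atTop (𝓝 0) ∧
      Tendsto (fun k => S s (z k) - z k) atTop (𝓝 0) := by
  have hmu0 : 0 < 1 - lam := sub_pos.2 hlam1
  have hnorm : ∀ u ∈ J, ∀ x ∈ D, ‖S u x‖ ≤ ‖x‖ := fun u hu x hx => by
    simpa [hS0 u hu] using hSnonexp u hu 0 hD0 x hx (by simpa using hDK hx)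
  have hscale : ∀ c : ℝ, 0 ≤ c → c ≤ 1 → ∀ x ∈ D, c • x ∈ D := fun c hc0 hc1 x hx =>
    hDconvex.smul_mem_of_zero_mem hD0 hx ⟨hc0, hc1⟩
  have hsub : ∀ c : ℝ, c ≤ 1 → ∀ x ∈ D, x - c • x ∈ K := fun c hc x hx => by
    have : x - c • x = (1 - c) • x := by rw [sub_smul, one_smul]
    exact this ▸ hKcone _ (sub_nonneg.2 hc) _ (hDK hx)
  set y : ℕ → H := fun k => S (t k) (z k) with hy
  have hyD : ∀ k, y k ∈ D := fun k => hSself _ (htJ k) _ (hzD k)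
  have hyz : ∀ k, ‖y k‖ ≤ ‖z k‖ := fun k => hnorm _ (htJ k) _ (hzD k)
  have hz1 : ∀ k, z (k + 1) - (1 - lam) • z k = lam • y k := fun k => by rw [hz]; abel
  have hz2 : ∀ k, z (k + 1) - lam • y k = (1 - lam) • z k := fun k => by rw [hz]; abel
  have hanti : Antitone fun k => ‖z k‖ := antitone_nat_of_succ_le fun k => by
    rw [hz]
    refine (norm_add_le _ _).trans ?_
    rw [norm_smul, norm_smul, Real.norm_of_nonneg hmu0.le, Real.norm_of_nonneg hlam0.le]
    have := mul_le_mul_of_nonneg_left (hyz k) hlam0.le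
    simp only [hy] at this
    linarith
  obtain ⟨r, hr⟩ : ∃ r, Tendsto (fun k => ‖z k‖) atTop (𝓝 r) :=
    ⟨_, tendsto_atTop_ciInf hanti ⟨0, by rintro _ ⟨k, rfl⟩; exact norm_nonneg _⟩⟩
  have hr1 : Tendsto (fun k => ‖z (k + 1)‖) atTop (𝓝 r) := (tendsto_add_atTop_iff_nat 1).2 hr
  have hsmul_zero : ∀ {c : ℝ} {f : ℕ → H}, c ≠ 0 → Tendsto (fun k => c • f k) atTop (𝓝 0) →
      Tendsto f atTop (𝓝 0) := fun {c f} hc h => by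
    simpa [smul_smul, inv_mul_cancel₀ hc] using h.const_smul c⁻¹
  have hyz1 : Tendsto (fun k => y k - z (k + 1)) atTop (𝓝 0) := by
    refine hsmul_zero hlam0.ne' ?_
    simp_rw [smul_sub]
    refine tendsto_sub_smul_zero_of_norm_le hlam0.le hlam1.le hr1
      (A := fun k => lam * ‖z k‖) (B := fun k => (1 - lam) * ‖z k‖) (fun k => ?_)
      (hr.const_mul _) (fun k => ?_) (hr.const_mul _)
    · rw [norm_smul, Real.norm_of_nonneg hlam0.le]
      exact mul_le_mul_of_nonneg_left (hyz k) hlam0.le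
    · rw [hz2, norm_smul, Real.norm_of_nonneg hmu0.le]
  have hzz : Tendsto (fun k => z (k + 1) - z k) atTop (𝓝 0) := by
    refine hsmul_zero hmu0.ne' ?_
    have := hyz1.const_smul lam
    rw [smul_zero] at this
    refine this.congr fun k => ?_
    rw [smul_sub, ← hz1 k]
    module
  refine ⟨hzz, ?_⟩
  have hyzk : Tendsto (fun k => y k - z k) atTop (𝓝 0) := by
    simpa using hyz1.add hzz
  have hyr : Tendsto (fun k => ‖y k‖) atTop (𝓝 r) := by
    refine tendsto_of_tendsto_of_dist hr
      (squeeze_zero (fun _ => dist_nonneg) (fun k => ?_) (by simpa using hyzk.norm))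
    rw [dist_comm, Real.dist_eq]
    exact abs_norm_sub_norm_le _ _
  have hyr1 : Tendsto (fun k => ‖y (k + 1)‖) atTop (𝓝 r) := (tendsto_add_atTop_iff_nat 1).2 hyr
  have hzcD : ∀ k, (1 - lam) • z k ∈ D := fun k => hscale _ hmu0.le (by linarith) _ (hzD k)
  let w : ℕ → H := fun k => S (t k) ((1 - lam) • z k)
  have hwD : ∀ k, w k ∈ D := fun k => hSself _ (htJ k) _ (hzcD k)
  have hlwD : ∀ k, lam • w k ∈ D := fun k => hscale _ hlam0.le hlam1.le _ (hwD k)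
  have hwnorm : ∀ k, ‖w k‖ ≤ (1 - lam) * ‖z k‖ := fun k => by
    simpa [norm_smul, Real.norm_of_nonneg hmu0.le] using hnorm _ (htJ k) _ (hzcD k)
  have hwy : Tendsto (fun k => w k - (1 - lam) • y k) atTop (𝓝 0) := by
    refine tendsto_sub_smul_zero_of_norm_le hmu0.le (by linarith) hyr
      (A := fun k => (1 - lam) * ‖z k‖) (B := fun k => (1 - (1 - lam)) * ‖z k‖) hwnorm
      (hr.const_mul _) (fun k => ?_) (hr.const_mul _)
    refine (hSnonexp _ (htJ k) _ (hzcD k) _ (hzD k) (hsub _ (by linarith) _ (hzD k))).trans ?_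
    have : z k - (1 - lam) • z k = (1 - (1 - lam)) • z k := by module
    rw [this, norm_smul, Real.norm_of_nonneg (by linarith)]
  have hSw : ∀ k, S s (w k) = S (t (k + 1)) ((1 - lam) • z k) := fun k => by
    rw [ht, hSsemi _ hs _ (htJ k) _ (hzcD k)]
  have hSwnorm : ∀ k, ‖S s (w k)‖ ≤ (1 - lam) * ‖z k‖ := fun k =>
    (hnorm _ hs _ (hwD k)).trans (hwnorm k)
  have hSwy : Tendsto (fun k => S s (w k) - (1 - lam) • y (k + 1)) atTop (𝓝 0) := by
    refine tendsto_sub_smul_zero_of_norm_le hmu0.le (by linarith) hyr1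
      (A := fun k => (1 - lam) * ‖z k‖) (B := fun k => (1 - (1 - lam)) * ‖y k‖) hSwnorm
      (hr.const_mul _) (fun k => ?_) (hyr.const_mul _)
    rw [hSw]
    refine (hSnonexp _ (htJ _) _ (hzcD k) _ (hzD (k + 1)) ?_).trans ?_
    · rw [hz1]; exact hKcone _ hlam0.le _ (hDK (hyD k))
    · rw [hz1, norm_smul, Real.norm_of_nonneg hlam0.le, sub_sub_cancel]
  have hSwr : Tendsto (fun k => ‖S s (w k)‖) atTop (𝓝 ((1 - lam) * r)) := by
    refine tendsto_of_tendsto_of_dist (hyr1.const_mul (1 - lam))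
      (squeeze_zero (fun _ => dist_nonneg) (fun k => ?_) (by simpa using hSwy.norm))
    rw [dist_comm, Real.dist_eq]
    simpa [norm_smul, abs_of_pos hmu0] using abs_norm_sub_norm_le (S s (w k)) ((1 - lam) • y (k + 1))
  have hlwnorm : ∀ k, ‖S s (lam • w k)‖ ≤ lam * (1 - lam) * ‖z k‖ := fun k => by
    refine (hnorm _ hs _ (hlwD k)).trans ?_
    rw [norm_smul, Real.norm_of_nonneg hlam0.le, mul_assoc]
    exact mul_le_mul_of_nonneg_left (hwnorm k) hlam0.le
  have hlw1 : Tendsto (fun k => S s (lam • w k) - lam • S s (w k)) atTop (𝓝 0) := by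
    refine tendsto_sub_smul_zero_of_norm_le hlam0.le hlam1.le hSwr
      (A := fun k => lam * (1 - lam) * ‖z k‖) (B := fun k => (1 - lam) * ((1 - lam) * ‖z k‖))
      hlwnorm ?_ (fun k => ?_) ((hr.const_mul _).const_mul _)
    · rw [← mul_assoc]; exact hr.const_mul _
    refine (hSnonexp _ hs _ (hlwD k) _ (hwD k) (hsub _ hlam1.le _ (hwD k))).trans ?_
    have : w k - lam • w k = (1 - lam) • w k := by module
    rw [this, norm_smul, Real.norm_of_nonneg hmu0.le]
    exact mul_le_mul_of_nonneg_left (hwnorm k) hmu0.le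
  have hSzr : Tendsto (fun k => ‖S s (z (k + 1))‖) atTop (𝓝 r) := by
    refine tendsto_of_tendsto_of_tendsto_of_le_of_le hyr1 hr1 (fun k => ?_)
      (fun k => hnorm _ hs _ (hzD _))
    have : y (k + 1) = S (t k) (S s (z (k + 1))) := by
      rw [← hSsemi _ (htJ k) _ hs _ (hzD _), add_comm (t k), ← ht]
    simp only [this]
    exact hnorm _ (htJ k) _ (hSself _ hs _ (hzD _))
  have hzlw : Tendsto (fun k => ‖z (k + 1) - lam • w k‖) atTop (𝓝 ((1 - lam * (1 - lam)) * r)) := by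
    refine tendsto_of_tendsto_of_dist (hr1.const_mul (1 - lam * (1 - lam)))
      (squeeze_zero (g := fun k => ‖lam • (w k - (1 - lam) • y k) +
        (lam * (1 - lam)) • (y k - z (k + 1))‖) (fun _ => dist_nonneg) (fun k => ?_) ?_)
    · have h1 : 0 ≤ 1 - lam * (1 - lam) := by nlinarith
      have e : lam • (w k - (1 - lam) • y k) + (lam * (1 - lam)) • (y k - z (k + 1)) =
          (1 - lam * (1 - lam)) • z (k + 1) - (z (k + 1) - lam • w k) := by module
      rw [e, Real.dist_eq]
      simpa only [norm_smul, Real.norm_of_nonneg h1] using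
        abs_norm_sub_norm_le ((1 - lam * (1 - lam)) • z (k + 1)) (z (k + 1) - lam • w k)
    · simpa using ((hwy.const_smul lam).add (hyz1.const_smul (lam * (1 - lam)))).norm
  have hlw2 : Tendsto (fun k => S s (lam • w k) - (lam * (1 - lam)) • S s (z (k + 1)))
      atTop (𝓝 0) := by
    refine tendsto_sub_smul_zero_of_norm_le (by positivity) (by nlinarith) hSzr hlwnorm
      (hr.const_mul _) (fun k => hSnonexp _ hs _ (hlwD k) _ (hzD _) ?_) hzlw
    have hwle : y k - w k ∈ K :=
      hSmono _ (htJ k) _ (hzcD k) _ (hzD k) (hsub _ (by linarith) _ (hzD k))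
    have e : z (k + 1) - lam • w k = (1 - lam) • z k + lam • (y k - w k) := by rw [← hz2]; module
    rw [e]
    exact hKadd _ (hKcone _ hmu0.le _ (hDK (hzD k))) _ (hKcone _ hlam0.le _ hwle)
  rw [← tendsto_add_atTop_iff_nat 1]
  refine hsmul_zero (c := lam * (1 - lam)) (by positivity) ?_
  have h := (((hlw1.sub hlw2).add (hSwy.const_smul lam)).add
    (((tendsto_add_atTop_iff_nat 1).2 hyzk).const_smul (lam * (1 - lam))))
  simp only [smul_zero, sub_zero, add_zero] at h
  refine h.congr fun k => ?_
  module

/-- A monotone nonexpansive semigroup has a common fixed point above any point that lies below its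
whole orbit. -/
theorem exists_common_fixed_point {H : Type*} [NormedAddCommGroup H] [InnerProductSpace ℝ H]
    [CompleteSpace H] {K C : Set H} {J : Set ℝ} {T : ℝ → H → H} (hKclosed : IsClosed K)
    (hKconvex : Convex ℝ K) (hJ0 : (0 : ℝ) ∈ J) (hJadd : ∀ u ∈ J, ∀ v ∈ J, u + v ∈ J)
    (hCbdd : Bornology.IsBounded C) (hCclosed : IsClosed C) (hCconvex : Convex ℝ C)
    (hTself : ∀ u ∈ J, ∀ x ∈ C, T u x ∈ C)
    (hT0 : ∀ x ∈ C, T 0 x = x)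
    (hTsemi : ∀ u ∈ J, ∀ v ∈ J, ∀ x ∈ C, T (u + v) x = T u (T v x))
    (hTmono : ∀ u ∈ J, ∀ x ∈ C, ∀ y ∈ C, y - x ∈ K → T u y - T u x ∈ K)
    (hTnonexp : ∀ u ∈ J, ∀ x ∈ C, ∀ y ∈ C, (y - x ∈ K ∨ x - y ∈ K) → ‖T u x - T u y‖ ≤ ‖x - y‖)
    {x0 : H} (hx0 : x0 ∈ C) (hx0le : ∀ u ∈ J, T u x0 - x0 ∈ K) :
    ∃ p ∈ C, p - x0 ∈ K ∧ ∀ u ∈ J, T u p = p := by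
  let l : Filter ℝ :=
    { sets := {A | ∃ v ∈ J, ∀ w ∈ J, v + w ∈ A}
      univ_sets := ⟨0, hJ0, fun _ _ => trivial⟩
      sets_of_superset := fun ⟨v, hv, h⟩ hAB => ⟨v, hv, fun w hw => hAB (h w hw)⟩
      inter_sets := fun ⟨v, hv, h⟩ ⟨v', hv', h'⟩ => ⟨v + v', hJadd _ hv _ hv', fun w hw =>
        ⟨by rw [add_assoc]; exact h _ (hJadd _ hv' _ hw),
          by rw [add_comm v, add_assoc]; exact h' _ (hJadd _ hv _ hw)⟩⟩ }
  have hl : ∀ P : ℝ → Prop, (∀ᶠ u in l, P u) ↔ ∃ v ∈ J, ∀ w ∈ J, P (v + w) := fun P => Iff.rfl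
  have : l.NeBot := neBot_iff.2 fun h => by
    obtain ⟨v, -, hv⟩ := (hl fun _ => False).1 (by simp [h])
    exact hv 0 hJ0
  obtain ⟨p, hpC, huniq, hloc⟩ := exists_asymptotic_center_s9 (l := l) (a := fun u => T u x0)
    hCclosed hCconvex hCbdd
    ((hl _).2 ⟨0, hJ0, fun w hw => hTself _ (hJadd _ hJ0 _ hw) _ hx0⟩)
  have hle : ∀ u ∈ J, p - T u x0 ∈ K := fun u hu => by
    refine (hloc (C ∩ (fun z => z - T u x0) ⁻¹' K) Set.inter_subset_left
      (hCclosed.inter (hKclosed.preimage (by fun_prop))) (hCconvex.inter ?_)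
      ((hl _).2 ⟨u, hu, fun w hw => ⟨hTself _ (hJadd _ hu _ hw) _ hx0, ?_⟩⟩)).2
    · simpa only [sub_eq_add_neg] using hKconvex.translate_preimage_left (-T u x0)
    · rw [Set.mem_preimage, hTsemi u hu w hw _ hx0]
      exact hTmono _ hu _ hx0 _ (hTself _ hw _ hx0) (hx0le w hw)
  refine ⟨p, hpC, by simpa [hT0 x0 hx0] using hle 0 hJ0, fun u hu => ?_⟩
  refine huniq _ (hTself _ hu _ hpC) fun ρ hρ => ?_
  obtain ⟨v, hv, h⟩ := (hl _).1 hρ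
  refine (hl _).2 ⟨u + v, hJadd _ hu _ hv, fun w hw => ?_⟩
  have hvw := hJadd _ hv _ hw
  rw [add_assoc, hTsemi _ hu _ hvw _ hx0]
  exact (hTnonexp _ hu _ (hTself _ hvw _ hx0) _ hpC (Or.inl (hle _ hvw))).trans (h w hw)

/-- A strictly increasing sequence of naturals at bounded distance from the identity is eventually
a translation. -/
theorem StrictMono.eventually_eq_add_of_le_add {j : ℕ → ℕ} (hj : StrictMono j) {P : ℕ}
    (hP : ∀ k, j k ≤ k + P) : ∃ c N, ∀ k ≥ N, j k = k + c := by
  have hmono : Monotone fun k => j k - k := monotone_nat_of_le_succ fun k => by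
    have := hj (Nat.lt_succ_self k)
    have := hj.id_le k
    simp only [Nat.succ_eq_add_one, id] at *
    omega
  obtain ⟨N, hN⟩ : ∃ N, ∀ k, j k - k ≤ j N - N := by
    have hbdd : BddAbove (Set.range fun k => j k - k) :=
      ⟨P, by rintro _ ⟨k, rfl⟩; have := hP k; simp only; omega⟩
    obtain ⟨N, hN⟩ := Nat.sSup_mem (Set.range_nonempty _) hbdd
    exact ⟨N, fun k => (le_csSup hbdd ⟨k, rfl⟩).trans_eq hN.symm⟩
  refine ⟨j N - N, N, fun k hk => ?_⟩
  have h1 := hN k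
  have h2 : j N - N ≤ j k - k := hmono hk
  have h3 : k ≤ j k := hj.id_le k
  omega

/-- If consecutive increments tend to zero, so do increments over any fixed number of steps. -/
theorem tendsto_add_sub_self_zero {E : Type*} [NormedAddCommGroup E] {x : ℕ → E}
    (hx : Tendsto (fun k => x (k + 1) - x k) atTop (𝓝 0)) (c : ℕ) :
    Tendsto (fun k => x (k + c) - x k) atTop (𝓝 0) := by
  induction c with
  | zero => simp
  | succ c ih =>
    have := ((tendsto_add_atTop_iff_nat c).2 hx).add ih
    simpa [add_assoc] using this

theorem stmt9
    {H : Type*} [NormedAddCommGroup H] [InnerProductSpace ℝ H] [CompleteSpace H]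
    (K : Set H) (hKclosed : IsClosed K) (hKconvex : Convex ℝ K)
    (hKcone : ∀ (α : ℝ), 0 ≤ α → ∀ x ∈ K, α • x ∈ K)
    (hKpointed : K ∩ (-K) = {0})
    (J : Set ℝ) (hJpos : ∀ u ∈ J, (0:ℝ) ≤ u) (hJ0 : (0:ℝ) ∈ J)
    (hJadd : ∀ u ∈ J, ∀ v ∈ J, u + v ∈ J)
    (hJunbdd : ∀ M : ℝ, ∃ u ∈ J, M < u)
    (C : Set H) (hCne : C.Nonempty) (hCbdd : Bornology.IsBounded C)
    (hCclosed : IsClosed C) (hCconvex : Convex ℝ C)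
    (T : ℝ → H → H)
    (hTself : ∀ u ∈ J, ∀ x ∈ C, T u x ∈ C)
    (hT0 : ∀ x ∈ C, T 0 x = x)
    (hTsemi : ∀ u ∈ J, ∀ v ∈ J, ∀ x ∈ C, T (u + v) x = T u (T v x))
    (hTcont : ∀ x ∈ C, ContinuousOn (fun u => T u x) J)
    (hTmono : ∀ u ∈ J, ∀ x ∈ C, ∀ y ∈ C, y - x ∈ K → T u y - T u x ∈ K)
    (hTnonexp : ∀ u ∈ J, ∀ x ∈ C, ∀ y ∈ C, (y - x ∈ K ∨ x - y ∈ K) →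
      ‖T u x - T u y‖ ≤ ‖x - y‖)
    (x0 : H) (hx0 : x0 ∈ C) (hx0le : ∀ u ∈ J, T u x0 - x0 ∈ K)
    (lam : ℝ) (hlam : lam ∈ Set.Ioo (0:ℝ) 1)
    (t : ℕ → ℝ) (htJ : ∀ k, t k ∈ J) (htmono : StrictMono t)
    (htlim : Tendsto t atTop atTop)
    (x : ℕ → H) (hxinit : x 0 = x0)
    (hxrec : ∀ k, x (k + 1) = (1 - lam) • x k + lam • T (t k) (x k))
    (s : ℝ) (hs : s ∈ J)
    (j : ℕ → ℕ) (hjmono : StrictMono j) (hjpos : ∀ k, 0 < j k)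
    (hjrec : ∀ k, t (j (k + 1)) = s + t (j k))
    (hjbdd : ∃ P : ℕ, ∀ k, j k ≤ k + P) :
    Tendsto (fun k => ‖x k - x (j k)‖) atTop (𝓝 0) ∧
    Tendsto (fun k => ‖x k - T s (x k)‖) atTop (𝓝 0) := by
  obtain ⟨hlam0, hlam1⟩ := hlam
  obtain ⟨P, hP⟩ := hjbdd
  obtain ⟨c, N, hN⟩ := hjmono.eventually_eq_add_of_le_add hP
  have hKadd : ∀ a ∈ K, ∀ b ∈ K, a + b ∈ K := fun a ha b hb => by
    have := hKcone 2 zero_le_two _ (hKconvex.midpoint_mem ha hb)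
    rwa [midpoint_eq_smul_add, smul_smul, mul_invOf_self, one_smul] at this
  obtain ⟨p, hpC, hpx0, hpT⟩ := exists_common_fixed_point hKclosed hKconvex hJ0 hJadd hCbdd hCclosed
    hCconvex hTself hT0 hTsemi hTmono hTnonexp hx0 hx0le
  have hxC : ∀ k, x k ∈ C ∧ p - x k ∈ K := by
    intro k
    induction k with
    | zero => exact hxinit ▸ ⟨hx0, hpx0⟩
    | succ k ih =>
      have h1 : p - T (t k) (x k) ∈ K := by
        simpa [hpT _ (htJ k)] using hTmono _ (htJ k) _ ih.1 _ hpC ih.2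
      rw [hxrec]
      refine ⟨hCconvex ih.1 (hTself _ (htJ k) _ ih.1) (sub_nonneg.2 hlam1.le) hlam0.le (by ring), ?_⟩
      have e : p - ((1 - lam) • x k + lam • T (t k) (x k)) =
          (1 - lam) • (p - x k) + lam • (p - T (t k) (x k)) := by module
      rw [e]
      exact hKadd _ (hKcone _ (sub_nonneg.2 hlam1.le) _ ih.2) _ (hKcone _ hlam0.le _ h1)
  have htrec : ∀ k, t (k + (N + c) + 1) = s + t (k + (N + c)) := fun k => by
    have h := hjrec (k + N)
    rw [hN _ (by omega), hN _ (by omega)] at h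
    convert h using 2
    · ring
    · rw [add_assoc]
  have h0 : (0 : H) ∈ K := by
    have : (0 : H) ∈ K ∩ (-K) := by rw [hKpointed]; rfl
    exact this.1
  obtain ⟨hstep, hfix⟩ := krasnoselskii_of_arithmetic (K := K) (D := {z | p - z ∈ C} ∩ K) (J := J)
    (S := fun u z => p - T u (p - z)) hKcone hKadd Set.inter_subset_right
    (Convex.inter (fun a ha b hb α β hα hβ hαβ => by
      have e : p - (α • a + β • b) = α • (p - a) + β • (p - b) := by
        obtain rfl : β = 1 - α := by linarith
        module
      change p - (α • a + β • b) ∈ C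
      rw [e]
      exact hCconvex ha hb hα hβ hαβ) hKconvex)
    ⟨by simpa using hpC, h0⟩
    (fun u hu z hz => ⟨by simpa using hTself u hu _ hz.1, by
      simpa [hpT u hu] using hTmono u hu _ hz.1 _ hpC (by simpa using hz.2)⟩)
    (fun u hu => by simp [hpT u hu])
    (fun u hu v hv z hz => by simp [hTsemi u hu v hv _ hz.1])
    (fun u hu a ha b hb hab => by
      simpa using hTmono u hu _ hb.1 _ ha.1 (by simpa using hab))
    (fun u hu a ha b hb hab => by
      simpa using hTnonexp u hu _ ha.1 _ hb.1 (Or.inr (by simpa using hab)))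
    hlam0 hlam1 hs (t := fun k => t (k + (N + c))) (fun k => htJ _)
    (fun k => by rw [← htrec]; congr 1; ring)
    (z := fun k => p - x (k + (N + c))) (fun k => ⟨by simpa using (hxC _).1, (hxC _).2⟩)
    (fun k => by
      have e : k + 1 + (N + c) = k + (N + c) + 1 := by ring
      simp only [e, hxrec, sub_sub_cancel]
      module)
  have hxstep : Tendsto (fun k => x (k + 1) - x k) atTop (𝓝 0) := by
    rw [← tendsto_add_atTop_iff_nat (N + c)]
    simpa [add_right_comm] using hstep.neg
  refine ⟨?_, ?_⟩
  · have h := (tendsto_add_sub_self_zero hxstep c).norm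
    rw [norm_zero] at h
    refine h.congr' ((eventually_ge_atTop N).mono fun k hk => ?_)
    simp only [hN k hk, norm_sub_rev (x k)]
  · rw [← tendsto_add_atTop_iff_nat (N + c)]
    simpa using hfix.norm
end

section
/- For each λ ∈ (0,1) and t ∈ J, the Picard iterates (T_t^λ)ⁿ x⁰ converge (in norm) as n → ∞ to a point x_t^λ ∈ C satisfying T_t^λ x_t^λ = x_t^λ, and moreover (T_t^λ)ⁿ x⁰ ⪯ x_t^λ for every n ∈ ℕ. -/
open Filter Topology RealInnerProductSpace

/-- A convex set closed under nonnegative scaling is closed under addition. -/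
theorem add_mem_of_convex_of_smul_mem {E : Type*} [AddCommGroup E] [Module ℝ E] {K : Set E}
    (hconvex : Convex ℝ K) (hcone : ∀ α : ℝ, 0 ≤ α → ∀ x ∈ K, α • x ∈ K)
    {x y : E} (hx : x ∈ K) (hy : y ∈ K) : x + y ∈ K := by
  have h := hcone 2 (by norm_num) _
    (hconvex hx hy (a := 1 / 2) (b := 1 / 2) (by norm_num) (by norm_num) (by norm_num))
  simpa [smul_add, smul_smul] using h

/-- An order-preserving self-map `F` of a closed set which contracts comparable pairs has, above
any `x₀` with `x₀ ⪯ F x₀`, a fixed point that is the limit of the iterates of `F` at `x₀` and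
bounds them from above. Here `x ⪯ y` means `y - x ∈ K`. -/
theorem exists_fixedPoint_tendsto_iterate_of_monotone_contraction
    {E : Type*} [NormedAddCommGroup E] [CompleteSpace E] {K C : Set E}
    (hKclosed : IsClosed K) (hKzero : (0 : E) ∈ K) (hKadd : ∀ x ∈ K, ∀ y ∈ K, x + y ∈ K)
    (hCclosed : IsClosed C) {F : E → E} (hFself : ∀ x ∈ C, F x ∈ C)
    (hFmono : ∀ x ∈ C, ∀ y ∈ C, y - x ∈ K → F y - F x ∈ K)
    {r : ℝ} (hr0 : 0 ≤ r) (hr1 : r < 1)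
    (hFcontr : ∀ x ∈ C, ∀ y ∈ C, y - x ∈ K → ‖F x - F y‖ ≤ r * ‖x - y‖)
    {x₀ : E} (hx₀ : x₀ ∈ C) (hle : F x₀ - x₀ ∈ K) :
    ∃ x ∈ C, Tendsto (fun n => F^[n] x₀) atTop (𝓝 x) ∧ F x = x ∧ ∀ n, x - F^[n] x₀ ∈ K := by
  have hmem (n : ℕ) : F^[n] x₀ ∈ C := by
    induction n with
    | zero => exact hx₀
    | succ n ih => rw [Function.iterate_succ_apply']; exact hFself _ ih
  have hstep (n : ℕ) : F^[n + 1] x₀ - F^[n] x₀ ∈ K := by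
    induction n with
    | zero => exact hle
    | succ n ih =>
      rw [Function.iterate_succ_apply' F (n + 1), Function.iterate_succ_apply' F n]
      rw [Function.iterate_succ_apply' F n] at ih
      exact hFmono _ (hmem n) _ (hFself _ (hmem n)) ih
  have hdist (n : ℕ) : dist (F^[n] x₀) (F^[n + 1] x₀) ≤ ‖x₀ - F x₀‖ * r ^ n := by
    induction n with
    | zero => simp [dist_eq_norm]
    | succ n ih =>
      rw [dist_eq_norm] at ih ⊢
      calc ‖F^[n + 1] x₀ - F^[n + 1 + 1] x₀‖
          ≤ r * ‖F^[n] x₀ - F^[n + 1] x₀‖ := by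
            rw [Function.iterate_succ_apply' F (n + 1)]
            nth_rw 1 [Function.iterate_succ_apply' F n]
            exact hFcontr _ (hmem n) _ (hmem (n + 1)) (hstep n)
        _ ≤ r * (‖x₀ - F x₀‖ * r ^ n) := by gcongr
        _ = ‖x₀ - F x₀‖ * r ^ (n + 1) := by ring
  obtain ⟨x, hx⟩ := cauchySeq_tendsto_of_complete (cauchySeq_of_le_geometric r _ hr1 hdist)
  have hxC : x ∈ C := hCclosed.mem_of_tendsto hx (.of_forall hmem)
  have hchain (n k : ℕ) : F^[n + k] x₀ - F^[n] x₀ ∈ K := by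
    induction k with
    | zero => simpa using hKzero
    | succ k ih =>
      have h := hKadd _ (hstep (n + k)) _ ih
      rwa [sub_add_sub_cancel] at h
  have hbound (n : ℕ) : x - F^[n] x₀ ∈ K := by
    refine hKclosed.mem_of_tendsto (hx.sub_const (F^[n] x₀)) ?_
    filter_upwards [eventually_ge_atTop n] with m hm
    obtain ⟨k, rfl⟩ := Nat.exists_eq_add_of_le hm
    exact hchain n k
  refine ⟨x, hxC, hx, ?_, hbound⟩
  have hFx : Tendsto (fun n => F^[n + 1] x₀) atTop (𝓝 (F x)) := by
    rw [tendsto_iff_norm_sub_tendsto_zero] at hx ⊢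
    refine squeeze_zero (fun _ => norm_nonneg _) (fun n => ?_) (by simpa using hx.const_mul r)
    rw [Function.iterate_succ_apply']
    exact hFcontr _ (hmem n) _ hxC (hbound n)
  exact tendsto_nhds_unique hFx (hx.comp (tendsto_add_atTop_nat 1))

theorem stmt12
    {H : Type*} [NormedAddCommGroup H] [InnerProductSpace ℝ H] [CompleteSpace H]
    (K : Set H) (hKclosed : IsClosed K) (hKconvex : Convex ℝ K)
    (hKcone : ∀ (α : ℝ), 0 ≤ α → ∀ x ∈ K, α • x ∈ K)
    (hKpointed : K ∩ (-K) = {0})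
    (J : Set ℝ) (hJpos : ∀ u ∈ J, (0:ℝ) ≤ u) (hJ0 : (0:ℝ) ∈ J)
    (hJadd : ∀ u ∈ J, ∀ v ∈ J, u + v ∈ J)
    (hJunbdd : ∀ M : ℝ, ∃ u ∈ J, M < u)
    (C : Set H) (hCne : C.Nonempty) (hCbdd : Bornology.IsBounded C)
    (hCclosed : IsClosed C) (hCconvex : Convex ℝ C)
    (T : ℝ → H → H)
    (hTself : ∀ u ∈ J, ∀ x ∈ C, T u x ∈ C)
    (hT0 : ∀ x ∈ C, T 0 x = x)
    (hTsemi : ∀ u ∈ J, ∀ v ∈ J, ∀ x ∈ C, T (u + v) x = T u (T v x))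
    (hTcont : ∀ x ∈ C, ContinuousOn (fun u => T u x) J)
    (hTmono : ∀ u ∈ J, ∀ x ∈ C, ∀ y ∈ C, y - x ∈ K → T u y - T u x ∈ K)
    (hTnonexp : ∀ u ∈ J, ∀ x ∈ C, ∀ y ∈ C, (y - x ∈ K ∨ x - y ∈ K) →
      ‖T u x - T u y‖ ≤ ‖x - y‖)
    (x0 : H) (hx0 : x0 ∈ C) (hx0le : ∀ u ∈ J, T u x0 - x0 ∈ K)
    (lam : ℝ) (hlam : lam ∈ Set.Ioo (0:ℝ) 1) (u : ℝ) (hu : u ∈ J) :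
    ∃ xl ∈ C,
      Tendsto (fun n => (fun z => (1 - lam) • T u z + lam • x0)^[n] x0) atTop (𝓝 xl) ∧
      (1 - lam) • T u xl + lam • x0 = xl ∧
      ∀ n : ℕ, xl - (fun z => (1 - lam) • T u z + lam • x0)^[n] x0 ∈ K := by
  obtain ⟨hlam0, hlam1⟩ := hlam
  have hr : 0 ≤ 1 - lam := by linarith
  have hdiff (x y : H) : ((1 - lam) • T u y + lam • x0) - ((1 - lam) • T u x + lam • x0) =
      (1 - lam) • (T u y - T u x) := by
    rw [add_sub_add_right_eq_sub, smul_sub]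
  refine exists_fixedPoint_tendsto_iterate_of_monotone_contraction
    (F := fun z => (1 - lam) • T u z + lam • x0) (r := 1 - lam) hKclosed
    (hKpointed.symm.subset rfl).1
    (fun x hx y hy => add_mem_of_convex_of_smul_mem hKconvex hKcone hx hy) hCclosed
    (fun x hx => hCconvex (hTself u hu x hx) hx0 hr hlam0.le (by ring)) ?_ hr (by linarith) ?_
    hx0 ?_
  · intro x hx y hy hxy
    simp only [hdiff]
    exact hKcone _ hr _ (hTmono u hu x hx y hy hxy)
  · intro x hx y hy hxy
    simp only [hdiff]
    rw [norm_smul, Real.norm_of_nonneg hr]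
    exact mul_le_mul_of_nonneg_left (hTnonexp u hu x hx y hy (.inl hxy)) hr
  · have h : (1 - lam) • T u x0 + lam • x0 - x0 = (1 - lam) • (T u x0 - x0) := by module
    simp only [h]
    exact hKcone _ hr _ (hx0le u hu)
end

section
/- The Browder sequence (x^k) satisfies, for every k ∈ ℕ: (i) x^k ⪯ x^{k+1}; and (ii) x^k ⪯ T_{t_k} x^k. -/
open Filter Topology RealInnerProductSpace

/-- A convex set closed under nonnegative scaling is closed under addition. -/
theorem add_mem_of_convex_of_smul_mem_s13 {H : Type*} [AddCommGroup H] [Module ℝ H] {K : Set H}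
    (hKconvex : Convex ℝ K) (hKcone : ∀ α : ℝ, 0 ≤ α → ∀ x ∈ K, α • x ∈ K)
    {a b : H} (ha : a ∈ K) (hb : b ∈ K) : a + b ∈ K := by
  have h := hKcone 2 (by norm_num) _
    (hKconvex ha hb (a := 1 / 2) (b := 1 / 2) (by norm_num) (by norm_num) (by norm_num))
  convert h using 1
  module

/-- The iterates from `x0` of the convex combination of a monotone map `S` with the constant
`x0 ≤ S x0` stay in `C`, lie above `x0`, increase, and lie below their images under `S`. -/
theorem iterate_convexComb_mem {H : Type*} [AddCommGroup H] [Module ℝ H] {K C : Set H}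
    (hadd : ∀ a ∈ K, ∀ b ∈ K, a + b ∈ K) (hKcone : ∀ α : ℝ, 0 ≤ α → ∀ x ∈ K, α • x ∈ K)
    (hC : Convex ℝ C) {S : H → H} (hS : ∀ x ∈ C, S x ∈ C)
    (hmono : ∀ x ∈ C, ∀ y ∈ C, y - x ∈ K → S y - S x ∈ K)
    {x0 : H} (hx0 : x0 ∈ C) (hle : S x0 - x0 ∈ K) {l : ℝ} (hl : l ∈ Set.Ioo (0 : ℝ) 1)
    {F : H → H} (hF : ∀ z, F z = (1 - l) • S z + l • x0) (n : ℕ) :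
    F^[n] x0 ∈ C ∧ F^[n] x0 - x0 ∈ K ∧ F^[n + 1] x0 - F^[n] x0 ∈ K ∧
      S (F^[n] x0) - F^[n] x0 ∈ K := by
  obtain ⟨hl0, hl1⟩ := hl
  have hl1' : 0 ≤ 1 - l := by linarith
  have hdiff : ∀ a b, F a - F b = (1 - l) • (S a - S b) := by
    intro a b
    rw [hF, hF]
    module
  have key : F^[n] x0 ∈ C ∧ F^[n] x0 - x0 ∈ K ∧ F (F^[n] x0) - F^[n] x0 ∈ K := by
    induction n with
    | zero =>
      refine ⟨hx0, ?_, ?_⟩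
      · simpa using hKcone 0 le_rfl _ hle
      · simp only [Function.iterate_zero, id_eq, hF]
        convert hKcone (1 - l) hl1' _ hle using 1
        module
    | succ n ih =>
      rw [Function.iterate_succ_apply']
      obtain ⟨hzC, hz0, hzF⟩ := ih
      have hFC : F (F^[n] x0) ∈ C := by
        rw [hF]
        exact hC (hS _ hzC) hx0 hl1' hl0.le (by ring)
      refine ⟨hFC, ?_, ?_⟩
      · convert hadd _ hzF _ hz0 using 1
        abel
      · convert hKcone (1 - l) hl1' _ (hmono _ hzC _ hFC hzF) using 1
        exact hdiff _ _
  obtain ⟨hzC, hz0, hzF⟩ := key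
  refine ⟨hzC, hz0, by rwa [Function.iterate_succ_apply'], ?_⟩
  have hS0 := hadd _ (hmono _ hx0 _ hzC hz0) _ hle
  convert hadd _ hzF _ (hKcone l hl0.le _ hS0) using 1
  rw [hF]
  module

theorem stmt13
    {H : Type*} [NormedAddCommGroup H] [InnerProductSpace ℝ H] [CompleteSpace H]
    (K : Set H) (hKclosed : IsClosed K) (hKconvex : Convex ℝ K)
    (hKcone : ∀ (α : ℝ), 0 ≤ α → ∀ x ∈ K, α • x ∈ K)
    (hKpointed : K ∩ (-K) = {0})
    (J : Set ℝ) (hJpos : ∀ u ∈ J, (0:ℝ) ≤ u) (hJ0 : (0:ℝ) ∈ J)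
    (hJadd : ∀ u ∈ J, ∀ v ∈ J, u + v ∈ J)
    (hJunbdd : ∀ M : ℝ, ∃ u ∈ J, M < u)
    (C : Set H) (hCne : C.Nonempty) (hCbdd : Bornology.IsBounded C)
    (hCclosed : IsClosed C) (hCconvex : Convex ℝ C)
    (T : ℝ → H → H)
    (hTself : ∀ u ∈ J, ∀ x ∈ C, T u x ∈ C)
    (hT0 : ∀ x ∈ C, T 0 x = x)
    (hTsemi : ∀ u ∈ J, ∀ v ∈ J, ∀ x ∈ C, T (u + v) x = T u (T v x))
    (hTcont : ∀ x ∈ C, ContinuousOn (fun u => T u x) J)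
    (hTmono : ∀ u ∈ J, ∀ x ∈ C, ∀ y ∈ C, y - x ∈ K → T u y - T u x ∈ K)
    (hTnonexp : ∀ u ∈ J, ∀ x ∈ C, ∀ y ∈ C, (y - x ∈ K ∨ x - y ∈ K) →
      ‖T u x - T u y‖ ≤ ‖x - y‖)
    (x0 : H) (hx0 : x0 ∈ C) (hx0le : ∀ u ∈ J, T u x0 - x0 ∈ K)
    (lam : ℕ → ℝ) (hlam : ∀ k, lam k ∈ Set.Ioo (0:ℝ) 1) (hlamanti : StrictAnti lam)
    (t : ℕ → ℝ) (ht0J : t 0 ∈ J) (ht0ne : t 0 ≠ 0) (htrec : ∀ k, t (k + 1) = 2 * t k)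
    (x : ℕ → H)
    (hx : ∀ k, Tendsto
      (fun n => (fun z => (1 - lam k) • T (t k) z + lam k • x0)^[n] x0)
      atTop (𝓝 (x k))) :
    ∀ k : ℕ, x (k + 1) - x k ∈ K ∧ T (t k) (x k) - x k ∈ K := by
  have hadd : ∀ a ∈ K, ∀ b ∈ K, a + b ∈ K := fun a ha b hb =>
    add_mem_of_convex_of_smul_mem_s13 hKconvex hKcone ha hb
  have htJ : ∀ k, t k ∈ J := by
    intro k
    induction k with
    | zero => exact ht0J
    | succ k ih =>
      rw [htrec, two_mul]
      exact hJadd _ ih _ ih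
  set F : ℕ → H → H := fun k z => (1 - lam k) • T (t k) z + lam k • x0
  replace hx : ∀ k, Tendsto (fun n => (F k)^[n] x0) atTop (𝓝 (x k)) := hx
  have hF : ∀ k z, F k z = (1 - lam k) • T (t k) z + lam k • x0 := fun _ _ => rfl
  have hit := fun k n => iterate_convexComb_mem hadd hKcone hCconvex (hTself _ (htJ k))
    (hTmono _ (htJ k)) hx0 (hx0le _ (htJ k)) (hlam k) (hF k) n
  clear_value F
  intro k
  constructor
  · refine hKclosed.mem_of_tendsto ((hx (k + 1)).sub (hx k)) (Eventually.of_forall fun n => ?_)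
    induction n with
    | zero => simpa using hKcone 0 le_rfl _ (hx0le 0 hJ0)
    | succ n ih =>
      simp only [Function.iterate_succ_apply']
      obtain ⟨hzC, hz0, -, hzT⟩ := hit k n
      obtain ⟨hwC, -, -, -⟩ := hit (k + 1) n
      generalize (F k)^[n] x0 = z at *
      generalize (F (k + 1))^[n] x0 = w at *
      have hTzC := hTself _ (htJ k) _ hzC
      have hTwC := hTself _ (htJ k) _ hwC
      have hzTw : T (t k) w - z ∈ K := by
        convert hadd _ (hTmono _ (htJ k) _ hzC _ hwC ih) _ hzT using 1
        abel
      have hTT : T (t (k + 1)) w - T (t k) z ∈ K := by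
        rw [htrec, two_mul, hTsemi _ (htJ k) _ (htJ k) _ hwC]
        exact hTmono _ (htJ k) _ hzC _ hTwC hzTw
      have hTz0 := hadd _ hzT _ hz0
      have hlt : lam (k + 1) < lam k := hlamanti k.lt_succ_self
      convert hadd _ (hKcone (1 - lam (k + 1)) (by linarith [(hlam (k + 1)).2]) _ hTT) _
        (hKcone (lam k - lam (k + 1)) (by linarith) _ hTz0) using 1
      rw [hF, hF]
      module
  · have hxC : x k ∈ C :=
      hCclosed.mem_of_tendsto (hx k) (Eventually.of_forall fun n => (hit k n).1)
    have hle : ∀ n, x k - (F k)^[n] x0 ∈ K := by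
      intro n
      refine hKclosed.mem_of_tendsto ((hx k).sub_const _) ?_
      filter_upwards [eventually_ge_atTop n] with m hm
      induction m, hm using Nat.le_induction with
      | base => simpa using hKcone 0 le_rfl _ (hx0le 0 hJ0)
      | succ m _ ih =>
        convert hadd _ (hit k m).2.2.1 _ ih using 1
        abel
    refine hKclosed.mem_of_tendsto ((hx k).const_sub _) (Eventually.of_forall fun n => ?_)
    convert hadd _ (hTmono _ (htJ k) _ (hit k n).1 _ hxC (hle n)) _ (hit k n).2.2.2 using 1
    abel
end

section
/- Let (Y,d) be a metric space, K ⊆ Y a nonempty bounded subset, and J an unbounded additive subsemigroup of [0,∞). Let Ξ = {S_t}_{t ∈ J} be a family of self-maps of K satisfying S_t ∘ S_{t'} = S_{t+t'} for all t, t' ∈ J, and assume Ξ is asymptotically regular: for every h ∈ J and y ∈ K, d(S_t y, S_h (S_t y)) → 0 as t → ∞ along J. Then for every t ∈ J with t > 0, the common fixed point set {y ∈ K : S_s y = y for all s ∈ J} equals the fixed point set of the single map S_t. -/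
open Filter Topology RealInnerProductSpace

theorem stmt14
    {Y : Type*} [MetricSpace Y]
    (K : Set Y) (hKne : K.Nonempty) (hKbdd : Bornology.IsBounded K)
    (J : Set ℝ) (hJpos : ∀ u ∈ J, (0:ℝ) ≤ u)
    (hJadd : ∀ u ∈ J, ∀ v ∈ J, u + v ∈ J)
    (hJunbdd : ∀ M : ℝ, ∃ u ∈ J, M < u)
    (S : ℝ → Y → Y) (hSself : ∀ u ∈ J, ∀ y ∈ K, S u y ∈ K)
    (hSsemi : ∀ u ∈ J, ∀ v ∈ J, ∀ y ∈ K, S u (S v y) = S (u + v) y)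
    (hAR : ∀ h ∈ J, ∀ y ∈ K, ∀ ε > 0, ∃ M : ℝ, ∀ u ∈ J, M ≤ u →
      dist (S u y) (S h (S u y)) < ε) :
    ∀ u ∈ J, 0 < u →
      {y ∈ K | ∀ v ∈ J, S v y = y} = {y ∈ K | S u y = y} := by
  intro u hu hu0
  ext y
  simp only [Set.mem_ofPred_eq]
  refine ⟨fun ⟨hy, hfix⟩ => ⟨hy, hfix u hu⟩, fun ⟨hy, hfix⟩ => ⟨hy, fun h hh => ?_⟩⟩
  have hmul : ∀ n : ℕ, ((n : ℝ) + 1) * u ∈ J ∧ S (((n : ℝ) + 1) * u) y = y := by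
    intro n
    induction n with
    | zero => simpa using ⟨hu, hfix⟩
    | succ n ih =>
      have hsucc : (((n + 1 : ℕ) : ℝ) + 1) * u = ((n : ℝ) + 1) * u + u := by
        push_cast
        ring
      rw [hsucc]
      exact ⟨hJadd _ ih.1 _ hu, by rw [← hSsemi _ ih.1 _ hu y hy, hfix, ih.2]⟩
  symm
  refine eq_of_forall_dist_le fun ε hε => ?_
  obtain ⟨M, hM⟩ := hAR h hh y hy ε hε
  obtain ⟨n, hn⟩ := exists_nat_ge (M / u)
  have hle : M ≤ ((n : ℝ) + 1) * u := by
    rw [div_le_iff₀ hu0] at hn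
    linarith
  have hdist := hM _ (hmul n).1 hle
  rw [(hmul n).2] at hdist
  exact hdist.le
end
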